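/- arXiv:2405.16015 — 3 statements merged into one kernel-verified Lean document; each statement's English description precedes it below -/
import Mathlib

section
/- For every p ∈ ℕ there exists a constant C such that for every negative integer s and every finite non-empty set S of integers all strictly greater than s: ∫_1^∞ |φ^{(p)}_{{s}∪S}(x) − (1/2)·φ^{(p)}_S(x)| dx ≤ C·2^{−|S|}·2^s. -/
open MeasureTheory

/-- Convolution of functions on `ℝ`. -/
noncomputable def rconv (f g : ℝ → ℝ) : ℝ → ℝ := fun x => ∫ y : ℝ, f y * g (x - y)

/-- The rescaling `φ_s(x) = 4^{-s} φ(4^{-s} x)`. -/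
noncomputable def phis (φ : ℝ → ℝ) (s : ℤ) : ℝ → ℝ :=
  fun x => (4 : ℝ) ^ (-s) * φ ((4 : ℝ) ^ (-s) * x)

/-- Convolution of the functions `φ_s` for `s` in a (nonempty) list. -/
noncomputable def convListR (f : ℤ → ℝ → ℝ) : List ℤ → ℝ → ℝ
  | [] => fun _ => 0
  | [s] => f s
  | s :: l => rconv (f s) (convListR f l)

/-- `φ_S`: the convolution of the functions `φ_s` for `s ∈ S`. -/
noncomputable def phiS (φ : ℝ → ℝ) (S : Finset ℤ) : ℝ → ℝ :=
  convListR (phis φ) (S.sort (· ≤ ·))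

namespace Blur

/-- Smooth with all derivatives bounded. -/
def Nice (g : ℝ → ℝ) : Prop :=
  ∀ k : ℕ, Differentiable ℝ (iteratedDeriv k g) ∧ ∃ B : ℝ, ∀ x, |iteratedDeriv k g x| ≤ B

/-- The weighted `L^1` norm. -/
noncomputable def wn (c : ℝ) (q : ℕ) (g : ℝ → ℝ) : ENNReal :=
  ∫⁻ x : ℝ, ENNReal.ofReal ((1 + c * |x|) ^ q) * ‖g x‖ₑ

lemma rconv_integrable {f g : ℝ → ℝ} (hf : Integrable f) (hg : Continuous g)
    {B : ℝ} (hB : ∀ x, |g x| ≤ B) (x : ℝ) : Integrable (fun y => f y * g (x - y)) := by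
  refine hf.mul_bdd (c := B) ?_ ?_
  · exact (hg.comp (continuous_const.sub continuous_id)).aestronglyMeasurable
  · exact Filter.Eventually.of_forall fun y => by simpa using hB (x - y)

lemma rconv_hasDerivAt {f g : ℝ → ℝ} (hf : Integrable f) (hg : Differentiable ℝ g)
    (hg' : Continuous (deriv g)) {B B' : ℝ} (hB : ∀ x, |g x| ≤ B) (hB' : ∀ x, |deriv g x| ≤ B')
    (x : ℝ) : HasDerivAt (rconv f g) (rconv f (deriv g) x) x := by
  have := hasDerivAt_integral_of_dominated_loc_of_deriv_le (μ := volume) (s := Set.univ)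
    (F := fun x y => f y * g (x - y)) (F' := fun x y => f y * deriv g (x - y))
    (bound := fun y => |f y| * B') (x₀ := x) Filter.univ_mem
    (Filter.Eventually.of_forall fun z => (rconv_integrable hf hg.continuous hB z).1)
    (rconv_integrable hf hg.continuous hB x)
    (rconv_integrable hf hg' hB' x).1
    (Filter.Eventually.of_forall fun y z _ => by
      rw [norm_mul, Real.norm_eq_abs, Real.norm_eq_abs]
      exact mul_le_mul_of_nonneg_left (hB' _) (abs_nonneg _))
    (hf.abs.mul_const _)
    (Filter.Eventually.of_forall fun y z _ => by
      have h1 : HasDerivAt (fun z => g (z - y)) (deriv g (z - y)) z :=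
        (hg (z - y)).hasDerivAt.comp_sub_const z y
      exact h1.const_mul _)
  exact this.2

lemma Nice.continuous {g : ℝ → ℝ} (hg : Nice g) (k : ℕ) : Continuous (iteratedDeriv k g) :=
  (hg k).1.continuous

lemma iteratedDeriv_rconv {f g : ℝ → ℝ} (hf : Integrable f) (hg : Nice g) (k : ℕ) :
    iteratedDeriv k (rconv f g) = rconv f (iteratedDeriv k g) := by
  induction k with
  | zero => simp
  | succ k ih =>
    obtain ⟨h1, B, hB⟩ := hg k
    obtain ⟨h2, B', hB'⟩ := hg (k + 1)
    rw [iteratedDeriv_succ, ih]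
    rw [iteratedDeriv_succ] at h2 hB' ⊢
    funext x
    exact (rconv_hasDerivAt hf h1 h2.continuous hB hB' x).deriv

lemma Nice.rconv {f g : ℝ → ℝ} (hf : Integrable f) (hg : Nice g) : Nice (rconv f g) := by
  intro k
  obtain ⟨h1, B, hB⟩ := hg k
  obtain ⟨h2, B', hB'⟩ := hg (k + 1)
  rw [iteratedDeriv_rconv hf hg]
  rw [iteratedDeriv_succ] at h2 hB'
  refine ⟨fun x => (rconv_hasDerivAt hf h1 h2.continuous hB hB' x).differentiableAt,
    ∫ y, |f y| * B, fun x => ?_⟩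
  refine (abs_integral_le_integral_abs).trans ?_
  refine integral_mono (rconv_integrable hf h1.continuous hB x).abs (hf.abs.mul_const _) fun y => ?_
  rw [abs_mul]
  exact mul_le_mul_of_nonneg_left (hB _) (abs_nonneg _)

lemma wn_rconv {f g : ℝ → ℝ} (hf : Continuous f) (hg : Continuous g) {c : ℝ} (hc : 0 ≤ c) (q : ℕ) :
    wn c q (rconv f g) ≤ wn c q f * wn c q g := by
  set F : ℝ → ENNReal := fun x => ENNReal.ofReal ((1 + c * |x|) ^ q) * ‖f x‖ₑ with hF
  set G : ℝ → ENNReal := fun x => ENNReal.ofReal ((1 + c * |x|) ^ q) * ‖g x‖ₑ with hG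
  have mF : Measurable F := by
    have := hf.measurable
    rw [hF]; fun_prop
  have mG : Measurable G := by
    have := hg.measurable
    rw [hG]; fun_prop
  have key : ∀ x y : ℝ, ENNReal.ofReal ((1 + c * |x|) ^ q) * ‖f y * g (x - y)‖ₑ ≤ F y * G (x - y) := by
    intro x y
    have h1 : (1 + c * |x|) ^ q ≤ (1 + c * |y|) ^ q * (1 + c * |x - y|) ^ q := by
      rw [← mul_pow]
      refine pow_le_pow_left₀ (by positivity) ?_ _
      have : |x| ≤ |y| + |x - y| := by
        have := abs_add_le y (x - y); simpa using this
      have h2 := mul_le_mul_of_nonneg_left this hc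
      have h3 : 0 ≤ (c * |y|) * (c * |x - y|) := by positivity
      nlinarith
    calc _ ≤ ENNReal.ofReal ((1 + c * |y|) ^ q * (1 + c * |x - y|) ^ q) * ‖f y * g (x - y)‖ₑ := by
          gcongr
      _ = _ := by
          rw [ENNReal.ofReal_mul (by positivity), enorm_mul, hF, hG]; ring
  calc wn c q (rconv f g) ≤ ∫⁻ x : ℝ, ∫⁻ y : ℝ, F y * G (x - y) := by
        unfold wn
        refine lintegral_mono fun x => ?_
        calc _ ≤ ENNReal.ofReal ((1 + c * |x|) ^ q) * ∫⁻ y, ‖f y * g (x - y)‖ₑ := by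
              gcongr; exact enorm_integral_le_lintegral_enorm _
          _ = ∫⁻ y, ENNReal.ofReal ((1 + c * |x|) ^ q) * ‖f y * g (x - y)‖ₑ := by
              rw [lintegral_const_mul' _ _ ENNReal.ofReal_ne_top]
          _ ≤ _ := lintegral_mono fun y => key x y
    _ = ∫⁻ y : ℝ, ∫⁻ x : ℝ, F y * G (x - y) := by
        refine lintegral_lintegral_swap (Measurable.aemeasurable ?_)
        exact (mF.comp measurable_snd).mul (mG.comp (measurable_fst.sub measurable_snd))
    _ = ∫⁻ y : ℝ, F y * wn c q g := by
        refine lintegral_congr fun y => ?_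
        rw [lintegral_const_mul _ (by fun_prop),
          lintegral_sub_right_eq_self G y]
        rfl
    _ = _ := by rw [lintegral_mul_const _ mF]; rfl

lemma lintegral_scale {a : ℝ} (ha : 0 < a) (F : ℝ → ENNReal) (hF : Measurable F) :
    ∫⁻ x, ENNReal.ofReal a * F (a * x) = ∫⁻ x, F x := by
  rw [lintegral_const_mul _ (by fun_prop),
    ← lintegral_map hF (measurable_const_mul a), Real.map_volume_mul_left ha.ne',
    lintegral_smul_measure, smul_eq_mul, ← mul_assoc, ← ENNReal.ofReal_mul ha.le,
    abs_of_pos (inv_pos.2 ha), mul_inv_cancel₀ ha.ne']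
  simp

lemma iteratedDeriv_schwartz (φ : SchwartzMap ℝ ℝ) (k : ℕ) :
    ∃ ψ : SchwartzMap ℝ ℝ, iteratedDeriv k φ = ψ := by
  induction k with
  | zero => exact ⟨φ, by simp⟩
  | succ k ih =>
    obtain ⟨ψ, hψ⟩ := ih
    refine ⟨SchwartzMap.derivCLM ℝ ℝ ψ, ?_⟩
    rw [iteratedDeriv_succ, hψ]
    rfl

lemma schwartz_weight_integrable (φ : SchwartzMap ℝ ℝ) (q : ℕ) :
    Integrable (fun x : ℝ => (1 + |x|) ^ q * |φ x|) := by
  have h0 := φ.integrable_pow_mul volume 0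
  have hq := φ.integrable_pow_mul volume q
  refine Integrable.mono' ((h0.add hq).const_mul (2 ^ (q - 1))) ?_ ?_
  · have := φ.continuous
    exact Continuous.aestronglyMeasurable (by fun_prop)
  · refine Filter.Eventually.of_forall fun x => ?_
    rw [Real.norm_of_nonneg (by positivity)]
    have := add_pow_le zero_le_one (abs_nonneg x) q
    simp only [Pi.add_apply, Real.norm_eq_abs, pow_zero, one_mul]
    calc _ ≤ _ := mul_le_mul_of_nonneg_right this (abs_nonneg _)
      _ = _ := by simp; ring

lemma phis_eq (φ : SchwartzMap ℝ ℝ) (s : ℤ) (q : ℕ) :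
    iteratedDeriv q (phis (fun y => φ y) s) =
      fun x => ((4 : ℝ) ^ (-s)) ^ q * ((4 : ℝ) ^ (-s) * iteratedDeriv q φ ((4 : ℝ) ^ (-s) * x)) := by
  have h := iteratedDeriv_comp_const_mul (n := q) (φ.smooth q) ((4 : ℝ) ^ (-s))
  unfold phis
  funext x
  rw [iteratedDeriv_const_mul_field, h]
  ring

lemma phis_nice (φ : SchwartzMap ℝ ℝ) (s : ℤ) : Nice (phis (fun y => φ y) s) := by
  intro k
  obtain ⟨ψ, hψ⟩ := iteratedDeriv_schwartz φ k
  rw [phis_eq, hψ]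
  have hd := ψ.differentiable
  refine ⟨by fun_prop, ?_⟩
  obtain ⟨B, hB⟩ := ψ.decay 0 0
  refine ⟨((4 : ℝ) ^ (-s)) ^ k * ((4 : ℝ) ^ (-s) * B), fun x => ?_⟩
  have h4 : (0 : ℝ) < (4 : ℝ) ^ (-s) := by positivity
  rw [abs_mul, abs_mul, abs_of_pos h4, abs_of_pos (pow_pos h4 k)]
  have := hB.2 ((4 : ℝ) ^ (-s) * x)
  simp only [pow_zero, one_mul, norm_iteratedFDeriv_zero, Real.norm_eq_abs] at this
  gcongr

lemma phis_integrable (φ : SchwartzMap ℝ ℝ) (s : ℤ) : Integrable (phis (fun y => φ y) s) := by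
  have : Integrable (fun x => φ ((4 : ℝ) ^ (-s) * x)) :=
    φ.integrable.comp_mul_left' (by positivity)
  exact this.const_mul _

lemma phis_continuous (φ : SchwartzMap ℝ ℝ) (s : ℤ) : Continuous (phis (fun y => φ y) s) := by
  have := φ.continuous
  unfold phis; fun_prop

lemma phis_integral (φ : SchwartzMap ℝ ℝ) (s : ℤ) : ∫ x, phis (fun y => φ y) s x = ∫ x, φ x := by
  have h4 : (0 : ℝ) < (4 : ℝ) ^ (-s) := by positivity
  unfold phis
  rw [integral_const_mul, Measure.integral_comp_mul_left (fun x => φ x), abs_of_pos (inv_pos.2 h4), smul_eq_mul,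
    mul_inv_cancel_left₀ h4.ne']

/-- `D_q`. -/
noncomputable def Dq (φ : SchwartzMap ℝ ℝ) (q : ℕ) : ℝ := ∫ x, (1 + |x|) ^ q * |iteratedDeriv q φ x|

lemma Dq_nonneg (φ : SchwartzMap ℝ ℝ) (q : ℕ) : 0 ≤ Dq φ q :=
  integral_nonneg fun x => by positivity

lemma wn_base (φ : SchwartzMap ℝ ℝ) (m : ℤ) (q : ℕ) :
    wn ((4 : ℝ) ^ (-m)) q (iteratedDeriv q (phis (fun y => φ y) m)) =
      ENNReal.ofReal (((4 : ℝ) ^ (-m)) ^ q * Dq φ q) := by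
  obtain ⟨ψ, hψ⟩ := iteratedDeriv_schwartz φ q
  have h4 : (0 : ℝ) < (4 : ℝ) ^ (-m) := by positivity
  rw [phis_eq, Dq, hψ]
  set a : ℝ := (4 : ℝ) ^ (-m) with ha
  have hψc := ψ.continuous
  have hm : Measurable (fun x : ℝ => ENNReal.ofReal (a ^ q) *
      ENNReal.ofReal ((1 + |x|) ^ q * |ψ x|)) := by
    apply Measurable.const_mul
    exact (Continuous.measurable (by fun_prop)).ennreal_ofReal
  rw [ENNReal.ofReal_mul (by positivity), ofReal_integral_eq_lintegral_ofReal
    (schwartz_weight_integrable ψ q) (Filter.Eventually.of_forall fun x => by positivity),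
    ← lintegral_const_mul' _ _ ENNReal.ofReal_ne_top, ← lintegral_scale h4 _ hm]
  unfold wn
  refine lintegral_congr fun x => ?_
  rw [← ofReal_norm, ← ENNReal.ofReal_mul (by positivity),
    ← ENNReal.ofReal_mul (by positivity), ← ENNReal.ofReal_mul (by positivity)]
  congr 1
  rw [norm_mul, norm_mul, norm_pow, Real.norm_of_nonneg h4.le, Real.norm_eq_abs, abs_mul,
    abs_of_pos h4]
  ring

/-- `K_q`. -/
noncomputable def Kq (φ : SchwartzMap ℝ ℝ) (q : ℕ) : ℝ := 2 * ∫ x, (1 + |x|) ^ q * |φ x|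

lemma Kq_nonneg (φ : SchwartzMap ℝ ℝ) (q : ℕ) : 0 ≤ Kq φ q :=
  mul_nonneg (by norm_num) (integral_nonneg fun x => by positivity)

lemma pow_conv {e u : ℝ} (he : 0 ≤ e) (he1 : e ≤ 1) (hu : 0 ≤ u) (q : ℕ) :
    (1 + e * u) ^ q ≤ 1 + e * (1 + u) ^ q := by
  have h := (convexOn_pow (𝕜 := ℝ) q).2 (x := 1) (y := 1 + u) (by simp)
    (by simp only [Set.mem_Ici]; positivity) (sub_nonneg.2 he1) he (by ring)
  simp only [smul_eq_mul, one_pow, mul_one] at h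
  have e1 : 1 - e + e * (1 + u) = 1 + e * u := by ring
  rw [e1] at h
  linarith

lemma wn_small (φ : SchwartzMap ℝ ℝ) (hnonneg : ∀ x, 0 ≤ φ x) (hone : ∫ x : ℝ, φ x = 1 / 2)
    {s m : ℤ} (hsm : s ≤ m) (q : ℕ) :
    wn ((4 : ℝ) ^ (-m)) q (phis (fun y => φ y) s) ≤
      ENNReal.ofReal (1 / 2 * (1 + Kq φ q * (4 : ℝ) ^ (s - m))) := by
  have h4 : (0 : ℝ) < (4 : ℝ) ^ (-s) := by positivity
  set e : ℝ := (4 : ℝ) ^ (s - m) with he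
  have he0 : 0 < e := by positivity
  have he1 : e ≤ 1 := zpow_le_one_of_nonpos₀ (by norm_num) (by omega)
  have hee : (4 : ℝ) ^ (-m) = e * (4 : ℝ) ^ (-s) := by
    rw [he, ← zpow_add₀ (by norm_num)]; congr 1; ring
  have hφc := φ.continuous
  have hi := schwartz_weight_integrable φ q
  have hm : Measurable (fun x : ℝ => ENNReal.ofReal (φ x + e * ((1 + |x|) ^ q * |φ x|))) :=
    (Continuous.measurable (by fun_prop)).ennreal_ofReal
  have : 1 / 2 * (1 + Kq φ q * e) = ∫ x, (φ x + e * ((1 + |x|) ^ q * |φ x|)) := by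
    rw [integral_add φ.integrable (hi.const_mul _), hone, integral_const_mul, Kq]
    ring
  have hi2 : Integrable (fun x => φ x + e * ((1 + |x|) ^ q * |φ x|)) :=
    φ.integrable.add (hi.const_mul _)
  rw [this, ofReal_integral_eq_lintegral_ofReal hi2
    (Filter.Eventually.of_forall fun x => by have := hnonneg x; positivity),
    ← lintegral_scale h4 _ hm]
  unfold wn
  refine lintegral_mono fun x => ?_
  simp only []
  rw [← ofReal_norm, ← ENNReal.ofReal_mul (by positivity), ← ENNReal.ofReal_mul (by positivity)]
  refine ENNReal.ofReal_le_ofReal ?_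
  have hx := hnonneg ((4 : ℝ) ^ (-s) * x)
  rw [phis, Real.norm_of_nonneg (by positivity), hee, abs_of_nonneg hx, mul_assoc e, abs_mul, abs_of_pos h4]
  have := pow_conv he0.le he1 (u := (4 : ℝ) ^ (-s) * |x|) (by positivity) q
  have h5 := mul_le_mul_of_nonneg_right this (by positivity : 0 ≤ (4 : ℝ) ^ (-s) * φ ((4 : ℝ) ^ (-s) * x))
  linarith

lemma main_list (φ : SchwartzMap ℝ ℝ) (hnonneg : ∀ x, 0 ≤ φ x) (hone : ∫ x : ℝ, φ x = 1 / 2)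
    (l : List ℤ) : ∀ a : ℤ, (a :: l).Pairwise (· < ·) →
    Nice (convListR (phis (fun y => φ y)) (a :: l)) ∧
    ∃ m : ℤ, a ≤ m ∧ ∀ q : ℕ,
      wn ((4 : ℝ) ^ (-m)) q (iteratedDeriv q (convListR (phis (fun y => φ y)) (a :: l))) ≤
        ENNReal.ofReal ((1 / 2) ^ l.length * ((4 : ℝ) ^ (-m)) ^ q * Dq φ q *
          Real.exp (Kq φ q * (1 - (4 : ℝ) ^ (a - m)))) := by
  induction l with
  | nil =>
    intro a _
    refine ⟨phis_nice φ a, a, le_rfl, fun q => ?_⟩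
    simp only [convListR, wn_base]
    simp
  | cons b l ih =>
    intro a hl
    obtain ⟨hN, m, hm, hq⟩ := ih b (List.pairwise_cons.1 hl).2
    have hab : a < b := (List.pairwise_cons.1 hl).1 b (by simp)
    have e : convListR (phis (fun y => φ y)) (a :: b :: l) =
      rconv (phis (fun y => φ y) a) (convListR (phis (fun y => φ y)) (b :: l)) := rfl
    rw [e]
    refine ⟨hN.rconv (phis_integrable φ a), m, by omega, fun q => ?_⟩
    rw [iteratedDeriv_rconv (phis_integrable φ a) hN]
    refine (wn_rconv (phis_continuous φ a) (hN.continuous q) (by positivity) q).trans ?_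
    refine (mul_le_mul' (wn_small φ hnonneg hone (by omega) q) (hq q)).trans ?_
    have hK := Kq_nonneg φ q
    have hD := Dq_nonneg φ q
    rw [← ENNReal.ofReal_mul (by positivity)]
    refine ENNReal.ofReal_le_ofReal ?_
    set x := (4 : ℝ) ^ (a - m)
    set y := (4 : ℝ) ^ (b - m)
    have hx : 0 < x := by positivity
    have hxy : 2 * x ≤ y := by
      have : (4 : ℝ) * x ≤ y := by
        have h1 : (4 : ℝ) * x = (4 : ℝ) ^ (a - m + 1) := by
          rw [zpow_add_one₀ (by norm_num)]; ring
        rw [h1]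
        exact zpow_le_zpow_right₀ (by norm_num) (by omega)
      linarith
    have hexp : (1 + Kq φ q * x) * Real.exp (Kq φ q * (1 - y)) ≤ Real.exp (Kq φ q * (1 - x)) := by
      calc _ ≤ Real.exp (Kq φ q * x) * Real.exp (Kq φ q * (1 - y)) := by
            gcongr; linarith [Real.add_one_le_exp (Kq φ q * x)]
        _ = Real.exp (Kq φ q * x + Kq φ q * (1 - y)) := (Real.exp_add _ _).symm
        _ ≤ _ := by
            refine Real.exp_le_exp.2 ?_
            nlinarith
    have hpos : 0 ≤ (1 / 2 : ℝ) ^ (l.length + 1) * ((4 : ℝ) ^ (-m)) ^ q * Dq φ q := by positivity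
    have := mul_le_mul_of_nonneg_left hexp hpos
    rw [List.length_cons]
    refine le_trans (le_of_eq ?_) this
    rw [pow_succ]; ring

lemma diff_inner {h : ℝ → ℝ} (hd : Differentiable ℝ h) (hc : Continuous (deriv h)) {y : ℝ}
    (hy : 0 ≤ y) (hy2 : y ≤ 1 / 2) :
    ∫⁻ x in Set.Ici (1 : ℝ), ‖h (x - y) - h x‖ₑ ≤
      ENNReal.ofReal y * ∫⁻ x in Set.Ici (1 / 2 : ℝ), ‖deriv h x‖ₑ := by
  have ftc : ∀ x : ℝ, h (x - y) - h x = ∫ t in (0 : ℝ)..1, deriv h (x - t * y) * (-y) := by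
    intro x
    have hder : ∀ t ∈ Set.uIcc (0 : ℝ) 1,
        HasDerivAt (fun t : ℝ => h (x - t * y)) (deriv h (x - t * y) * (-y)) t := by
      intro t _
      have h1 : HasDerivAt (fun t : ℝ => x - t * y) (-y) t := by
        simpa using ((hasDerivAt_id t).mul_const y).const_sub x
      exact (hd (x - t * y)).hasDerivAt.comp t h1
    rw [intervalIntegral.integral_eq_sub_of_hasDerivAt hder
      (Continuous.intervalIntegrable (by fun_prop) _ _)]
    simp
  set A := ∫⁻ x in Set.Ici (1 / 2 : ℝ), ‖deriv h x‖ₑ with hA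
  have hm := hc.measurable
  calc ∫⁻ x in Set.Ici (1 : ℝ), ‖h (x - y) - h x‖ₑ
      ≤ ∫⁻ x in Set.Ici (1 : ℝ), ∫⁻ t in Set.Ioc (0 : ℝ) 1,
          ‖deriv h (x - t * y)‖ₑ * ENNReal.ofReal y := by
        refine lintegral_mono fun x => ?_
        simp only []
        rw [ftc, intervalIntegral.integral_of_le zero_le_one]
        refine (enorm_integral_le_lintegral_enorm _).trans (le_of_eq ?_)
        refine lintegral_congr fun t => ?_
        rw [enorm_mul, enorm_neg, Real.enorm_of_nonneg hy]
    _ = ∫⁻ t in Set.Ioc (0 : ℝ) 1, ∫⁻ x in Set.Ici (1 : ℝ),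
          ‖deriv h (x - t * y)‖ₑ * ENNReal.ofReal y := by
        refine lintegral_lintegral_swap (Measurable.aemeasurable ?_)
        unfold Function.uncurry
        fun_prop
    _ ≤ ∫⁻ t in Set.Ioc (0 : ℝ) 1, A * ENNReal.ofReal y := by
        refine setLIntegral_mono' measurableSet_Ioc fun t ht => ?_
        rw [lintegral_mul_const _ (by fun_prop)]
        gcongr
        rw [hA, ← lintegral_indicator measurableSet_Ici, ← lintegral_indicator measurableSet_Ici,
          ← lintegral_sub_right_eq_self ((Set.Ici (1 / 2 : ℝ)).indicator _) (t * y)]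
        refine lintegral_mono fun x => ?_
        by_cases hx : x ∈ Set.Ici (1 : ℝ)
        · have : x - t * y ∈ Set.Ici (1 / 2 : ℝ) := by
            simp only [Set.mem_Ici] at hx ⊢
            have := ht.1; have := ht.2
            nlinarith
          rw [Set.indicator_of_mem hx, Set.indicator_of_mem this]
        · rw [Set.indicator_of_notMem hx]; exact zero_le
    _ = _ := by simp [mul_comm]

lemma diff_inner' {h : ℝ → ℝ} (hd : Continuous h) (y : ℝ) :
    ∫⁻ x in Set.Ici (1 : ℝ), ‖h (x - y) - h x‖ₑ ≤ 2 * ∫⁻ x, ‖h x‖ₑ := by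
  have hm := hd.measurable
  calc _ ≤ ∫⁻ x, ‖h (x - y) - h x‖ₑ := setLIntegral_le_lintegral _ _
    _ ≤ ∫⁻ x, (‖h (x - y)‖ₑ + ‖h x‖ₑ) := lintegral_mono fun x => enorm_sub_le
    _ = _ := by
      rw [lintegral_add_left (by fun_prop), lintegral_sub_right_eq_self (fun x => ‖h x‖ₑ) y, two_mul]

/-- moments -/
noncomputable def Mq (φ : SchwartzMap ℝ ℝ) (q : ℕ) : ℝ := ∫ x, |x| ^ q * |φ x|

lemma Mq_nonneg (φ : SchwartzMap ℝ ℝ) (q : ℕ) : 0 ≤ Mq φ q :=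
  integral_nonneg fun x => by positivity

lemma moment (φ : SchwartzMap ℝ ℝ) (s : ℤ) (q : ℕ) :
    ∫⁻ y, ‖phis (fun y => φ y) s y‖ₑ * ENNReal.ofReal (|y| ^ q) =
      ENNReal.ofReal (((4 : ℝ) ^ s) ^ q * Mq φ q) := by
  have h4 : (0 : ℝ) < (4 : ℝ) ^ (-s) := by positivity
  have hφc := φ.continuous
  have hm : Measurable (fun x : ℝ => ENNReal.ofReal (((4 : ℝ) ^ s) ^ q) *
      ENNReal.ofReal (|x| ^ q * |φ x|)) := by
    apply Measurable.const_mul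
    exact (Continuous.measurable (by fun_prop)).ennreal_ofReal
  have hi := φ.integrable_pow_mul volume q
  simp only [Real.norm_eq_abs] at hi
  rw [Mq, ENNReal.ofReal_mul (by positivity), ofReal_integral_eq_lintegral_ofReal hi
    (Filter.Eventually.of_forall fun x => by positivity),
    ← lintegral_const_mul' _ _ ENNReal.ofReal_ne_top, ← lintegral_scale h4 _ hm]
  refine lintegral_congr fun x => ?_
  rw [← ofReal_norm, ← ENNReal.ofReal_mul (by positivity),
    ← ENNReal.ofReal_mul (by positivity), ← ENNReal.ofReal_mul (by positivity)]
  congr 1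
  rw [phis, Real.norm_eq_abs, abs_mul, abs_mul, abs_of_pos h4, mul_pow]
  have : ((4 : ℝ) ^ s) ^ q * ((4 : ℝ) ^ (-s)) ^ q = 1 := by
    rw [← mul_pow, ← zpow_add₀ (by norm_num)]; simp
  linear_combination (-(4 : ℝ) ^ (-s) * |φ ((4 : ℝ) ^ (-s) * x)| * |x| ^ q) * this

lemma diff_outer (φ : SchwartzMap ℝ ℝ) (hsupp : ∀ x : ℝ, x ≤ 0 → φ x = 0)
    (hone : ∫ x : ℝ, φ x = 1 / 2) (s : ℤ) (N : ℕ) {h : ℝ → ℝ} (hd : Differentiable ℝ h)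
    (hc : Continuous (deriv h)) {B0 : ℝ} (hB0 : ∀ x, |h x| ≤ B0) {A B : ENNReal}
    (hA : ∫⁻ x in Set.Ici (1 / 2 : ℝ), ‖deriv h x‖ₑ ≤ A) (hB : ∫⁻ x, ‖h x‖ₑ ≤ B) :
    ∫⁻ x in Set.Ici (1 : ℝ), ‖rconv (phis (fun y => φ y) s) h x - 1 / 2 * h x‖ₑ ≤
      ENNReal.ofReal ((4 : ℝ) ^ s * Mq φ 1) * A +
      ENNReal.ofReal (2 ^ N * (((4 : ℝ) ^ s) ^ N * Mq φ N)) * (2 * B) := by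
  set f := phis (fun y => φ y) s with hf
  have hfc : Continuous f := phis_continuous φ s
  have hfi : Integrable f := phis_integrable φ s
  have mf := hfc.measurable
  have mh := hd.continuous.measurable
  have rep : ∀ x, rconv f h x - 1 / 2 * h x = ∫ y, f y * (h (x - y) - h x) := by
    intro x
    simp only [mul_sub]
    rw [integral_sub (rconv_integrable hfi hd.continuous hB0 x) (hfi.mul_const _),
      integral_mul_const, hf, phis_integral, hone]
    rfl
  calc ∫⁻ x in Set.Ici (1 : ℝ), ‖rconv f h x - 1 / 2 * h x‖ₑ
      ≤ ∫⁻ x in Set.Ici (1 : ℝ), ∫⁻ y, ‖f y‖ₑ * ‖h (x - y) - h x‖ₑ := by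
        refine lintegral_mono fun x => ?_
        simp only []
        rw [rep]
        refine (enorm_integral_le_lintegral_enorm _).trans (le_of_eq ?_)
        exact lintegral_congr fun t => enorm_mul _ _
    _ = ∫⁻ y, ∫⁻ x in Set.Ici (1 : ℝ), ‖f y‖ₑ * ‖h (x - y) - h x‖ₑ := by
        refine lintegral_lintegral_swap (Measurable.aemeasurable ?_)
        unfold Function.uncurry
        fun_prop
    _ = ∫⁻ y, ‖f y‖ₑ * ∫⁻ x in Set.Ici (1 : ℝ), ‖h (x - y) - h x‖ₑ := by
        refine lintegral_congr fun y => ?_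
        rw [lintegral_const_mul _ (by fun_prop)]
    _ ≤ ∫⁻ y, (‖f y‖ₑ * ENNReal.ofReal (|y| ^ 1) * A +
          ‖f y‖ₑ * ENNReal.ofReal (|y| ^ N) * (ENNReal.ofReal (2 ^ N) * (2 * B))) := by
        refine lintegral_mono fun y => ?_
        simp only []
        rcases le_or_gt y 0 with hy | hy
        · have : f y = 0 := by
            rw [hf, phis, hsupp, mul_zero]
            exact mul_nonpos_of_nonneg_of_nonpos (by positivity) hy
          simp [this]
        · rcases le_or_gt y (1 / 2) with hy2 | hy2
          · refine le_trans ?_ le_self_add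
            rw [mul_assoc, pow_one, abs_of_pos hy]
            gcongr
            exact (diff_inner hd hc hy.le hy2).trans (by gcongr)
          · refine le_trans ?_ le_add_self
            rw [mul_assoc, ← mul_assoc (ENNReal.ofReal _) (ENNReal.ofReal _),
              ← ENNReal.ofReal_mul (by positivity), ← mul_pow]
            gcongr
            have h1 : (1 : ENNReal) ≤ ENNReal.ofReal ((|y| * 2) ^ N) := by
              rw [ENNReal.one_le_ofReal]
              refine one_le_pow₀ ?_
              rw [abs_of_pos hy]; linarith
            calc _ ≤ 2 * ∫⁻ x, ‖h x‖ₑ := diff_inner' hd.continuous y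
              _ ≤ 1 * (2 * B) := by rw [one_mul]; gcongr
              _ ≤ _ := by gcongr
    _ = _ := by
        rw [lintegral_add_left (by fun_prop), lintegral_mul_const _ (by fun_prop),
          lintegral_mul_const _ (by fun_prop), moment, moment, ← mul_assoc (ENNReal.ofReal _) (ENNReal.ofReal _),
          ← ENNReal.ofReal_mul (mul_nonneg (by positivity) (Mq_nonneg φ N)), pow_one,
          mul_comm _ ((2 : ℝ) ^ N)]

lemma lint_le_wn {c : ℝ} (hc : 0 ≤ c) (q : ℕ) (g : ℝ → ℝ) : ∫⁻ x, ‖g x‖ₑ ≤ wn c q g := by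
  refine lintegral_mono fun x => ?_
  have h1 : (1 : ENNReal) ≤ ENNReal.ofReal ((1 + c * |x|) ^ q) := by
    rw [ENNReal.one_le_ofReal]
    refine one_le_pow₀ ?_
    have : 0 ≤ c * |x| := by positivity
    linarith
  calc ‖g x‖ₑ = 1 * ‖g x‖ₑ := (one_mul _).symm
    _ ≤ _ := by gcongr

lemma tail_le_wn {c : ℝ} (hc : 0 < c) (q : ℕ) (g : ℝ → ℝ) :
    ∫⁻ x in Set.Ici (1 / 2 : ℝ), ‖g x‖ₑ ≤ ENNReal.ofReal ((2 / c) ^ q) * wn c q g := by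
  unfold wn
  rw [← lintegral_const_mul' _ _ ENNReal.ofReal_ne_top]
  refine le_trans ?_ (setLIntegral_le_lintegral (Set.Ici (1 / 2 : ℝ)) _)
  refine setLIntegral_mono' measurableSet_Ici fun x hx => ?_
  rw [← mul_assoc, ← ENNReal.ofReal_mul (by positivity), ← mul_pow]
  have h1 : (1 : ENNReal) ≤ ENNReal.ofReal ((2 / c * (1 + c * |x|)) ^ q) := by
    rw [ENNReal.one_le_ofReal]
    refine one_le_pow₀ ?_
    have hx' : (1 / 2 : ℝ) ≤ |x| := le_trans hx (le_abs_self x)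
    have : 2 / c * (1 + c * |x|) = 2 / c + 2 * |x| := by field_simp
    rw [this]
    have : 0 < 2 / c := by positivity
    linarith
  calc ‖g x‖ₑ = 1 * ‖g x‖ₑ := (one_mul _).symm
    _ ≤ _ := by gcongr

end Blur

open Blur

theorem phi_blurring (φ : SchwartzMap ℝ ℝ)
    (hnonneg : ∀ x, 0 ≤ φ x)
    (hsupp : ∀ x : ℝ, x ≤ 0 → φ x = 0)
    (hone : ∫ x : ℝ, φ x = 1 / 2)
    (p : ℕ) :
    ∃ C : ℝ, ∀ s : ℤ, s < 0 → ∀ S : Finset ℤ, S.Nonempty → (∀ t ∈ S, s < t) →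
      ∫ x in Set.Ici (1 : ℝ),
          |iteratedDeriv p (phiS (fun y => φ y) (insert s S)) x -
            (1 / 2) * iteratedDeriv p (phiS (fun y => φ y) S) x| ≤
        C * (2 : ℝ) ^ (-(S.card : ℤ)) * (2 : ℝ) ^ s := by
  set E1 : ℝ := Dq φ (p + 1) * Real.exp (Kq φ (p + 1)) with hE1
  set E0 : ℝ := Dq φ p * Real.exp (Kq φ p) with hE0
  have hD1 := Dq_nonneg φ (p + 1)
  have hD0 := Dq_nonneg φ p
  have hM1 := Mq_nonneg φ 1
  have hMq := Mq_nonneg φ (p + 1)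
  have hE1n : 0 ≤ E1 := by positivity
  have hE0n : 0 ≤ E0 := by positivity
  refine ⟨Mq φ 1 * 2 ^ (p + 2) * E1 + 2 ^ (p + 3) * Mq φ (p + 1) * E0, ?_⟩
  intro s hs S hS hlt
  have hsort : (insert s S).sort (· ≤ ·) = s :: S.sort (· ≤ ·) :=
    Finset.sort_insert _ (fun b hb => (hlt b hb).le) (fun h => lt_irrefl _ (hlt s h))
  obtain ⟨a, l, hal⟩ : ∃ a l, S.sort (· ≤ ·) = a :: l := by
    cases hl : S.sort (· ≤ ·) with
    | nil =>
      have := Finset.length_sort (s := S) (· ≤ ·)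
      rw [hl] at this
      exact absurd this.symm (by simpa using hS.ne_empty)
    | cons a l => exact ⟨a, l, rfl⟩
  have hcard : S.card = l.length + 1 := by
    have := Finset.length_sort (s := S) (· ≤ ·)
    rw [hal] at this
    simpa using this.symm
  have hpw : (a :: l).Pairwise (· < ·) := by
    rw [← hal]; exact (Finset.sortedLT_sort S).pairwise
  have hsa : s < a := hlt a (by rw [← Finset.mem_sort (· ≤ ·), hal]; simp)
  obtain ⟨hN, m, ham, hq⟩ := main_list φ hnonneg hone l a hpw
  have e1 : phiS (fun y => φ y) S = convListR (phis (fun y => φ y)) (a :: l) := by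
    rw [phiS, hal]
  have e2 : phiS (fun y => φ y) (insert s S) =
      rconv (phis (fun y => φ y) s) (phiS (fun y => φ y) S) := by
    rw [e1, phiS, hsort, hal]; rfl
  rw [e2]
  rw [← e1] at hN hq
  set ψ := phiS (fun y => φ y) S with hψ
  rw [iteratedDeriv_rconv (phis_integrable φ s) hN]
  obtain ⟨h1, B, hB⟩ := hN p
  have h2 := hN.continuous (p + 1)
  have hq1 := hq (p + 1)
  have hq0 := hq p
  rw [iteratedDeriv_succ] at h2 hq1
  set h := iteratedDeriv p ψ with hh
  set c : ℝ := (4 : ℝ) ^ (-m) with hc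
  have hc0 : 0 < c := by positivity
  have hexp : ∀ q, Real.exp (Kq φ q * (1 - (4 : ℝ) ^ (a - m))) ≤ Real.exp (Kq φ q) := by
    intro q
    refine Real.exp_le_exp.2 ?_
    have := Kq_nonneg φ q
    have h3 : 0 < (4 : ℝ) ^ (a - m) := by positivity
    nlinarith
  have hA : ∫⁻ x in Set.Ici (1 / 2 : ℝ), ‖deriv h x‖ₑ ≤
      ENNReal.ofReal (2 ^ (p + 1) * (1 / 2) ^ l.length * E1) := by
    refine (tail_le_wn hc0 (p + 1) _).trans ?_
    refine (mul_le_mul_right hq1 _).trans ?_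
    rw [← ENNReal.ofReal_mul (by positivity)]
    refine ENNReal.ofReal_le_ofReal ?_
    calc _ ≤ (2 / c) ^ (p + 1) * ((1 / 2) ^ l.length * c ^ (p + 1) * Dq φ (p + 1) *
          Real.exp (Kq φ (p + 1))) := by
          gcongr; exact Real.exp_le_exp.1 (hexp _)
      _ = _ := by
          rw [hE1, div_pow]
          field_simp
  have hcs : c ≤ (4 : ℝ) ^ (-s) := zpow_le_zpow_right₀ (by norm_num) (by omega)
  have hBn : ∫⁻ x, ‖h x‖ₑ ≤
      ENNReal.ofReal ((1 / 2) ^ l.length * ((4 : ℝ) ^ (-s)) ^ p * E0) := by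
    refine (lint_le_wn hc0.le p _).trans (hq0.trans (ENNReal.ofReal_le_ofReal ?_))
    rw [hE0, ← mul_assoc]
    gcongr
    exact Real.exp_le_exp.1 (hexp _)
  have fin := diff_outer φ hsupp hone s (p + 1) h1 h2 hB hA hBn
  have h2e : (2 : ENNReal) = ENNReal.ofReal 2 := by simp
  rw [h2e, ← ENNReal.ofReal_mul (by positivity), ← ENNReal.ofReal_mul (by positivity),
    ← ENNReal.ofReal_mul (by positivity), ← ENNReal.ofReal_add (by positivity) (by positivity)] at fin
  have hle : (4 : ℝ) ^ s ≤ (2 : ℝ) ^ s := by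
    have : (4 : ℝ) ^ s = (2 : ℝ) ^ s * (2 : ℝ) ^ s := by
      rw [← mul_zpow]; norm_num
    rw [this]
    have h3 : (2 : ℝ) ^ s ≤ 1 := zpow_le_one_of_nonpos₀ (by norm_num) hs.le
    have h4 : 0 < (2 : ℝ) ^ s := by positivity
    nlinarith
  have hpw2 : (2 : ℝ) ^ (-(S.card : ℤ)) = (1 / 2) ^ (l.length) / 2 := by
    rw [zpow_neg, zpow_natCast, hcard, pow_succ, one_div, inv_pow, mul_inv]; ring
  have hcanc : ((4 : ℝ) ^ s) ^ (p + 1) * ((4 : ℝ) ^ (-s)) ^ p = (4 : ℝ) ^ s := by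
    rw [pow_succ, mul_right_comm, ← mul_pow, ← zpow_add₀ (by norm_num)]; simp
  rw [integral_eq_lintegral_of_nonneg_ae (Filter.Eventually.of_forall fun x => abs_nonneg _)]
  · refine ENNReal.toReal_le_of_le_ofReal (by positivity) ?_
    simp only [← Real.norm_eq_abs, ofReal_norm]
    refine fin.trans (ENNReal.ofReal_le_ofReal ?_)
    rw [hpw2]
    have hfac : 0 ≤ (Mq φ 1 * 2 ^ (p + 2) * E1 + 2 ^ (p + 3) * Mq φ (p + 1) * E0) *
      ((1 / 2) ^ l.length / 2) := by positivity
    refine le_trans (le_of_eq ?_) (mul_le_mul_of_nonneg_left hle hfac)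
    have e3 : (2 : ℝ) ^ (p + 2) = 2 ^ (p + 1) * 2 := by ring
    have e4 : (2 : ℝ) ^ (p + 3) = 2 ^ (p + 1) * 4 := by ring
    rw [e3, e4]
    linear_combination (2 ^ (p + 1) * Mq φ (p + 1) * 2 * (1 / 2) ^ l.length * E0) * hcanc
  · have hN2 := (hN.rconv (phis_integrable φ s)).continuous p
    rw [iteratedDeriv_rconv (phis_integrable φ s) hN] at hN2
    have := h1.continuous
    exact (Continuous.aestronglyMeasurable (by fun_prop))
end

section
/- The function φ is infinitely differentiable on ℝ and is a Schwartz function (for all m, k ∈ ℕ, sup_{x∈ℝ} |x|^m·|φ^{(k)}(x)| < ∞); φ(x) > 0 for every x > 0; and ∫_ℝ φ(x) dx = 1/2. -/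
open Real MeasureTheory

/-- The primitive Dirichlet character mod 4. -/
def dchi (n : ℕ) : ℤ := if n % 4 = 1 then 1 else if n % 4 = 3 then -1 else 0

/-- `φ(x) = (π/8)·∑_{n≥1} χ(n)·n·e^{−π²n²x/16}` for `x > 0`, and `0` for `x ≤ 0`. -/
noncomputable def phi (x : ℝ) : ℝ :=
  if 0 < x then
    (π / 8) * ∑' n : ℕ, (dchi n : ℝ) * (n : ℝ) * Real.exp (-(π ^ 2 * (n : ℝ) ^ 2 * x) / 16)
  else 0

noncomputable def gs (s : ℝ) (x : ℝ) : ℝ :=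
  if 0 < x then x ^ (-s) * Real.exp (-x⁻¹) else 0

lemma rpow_exp_bdd (s : ℝ) (hs : 0 ≤ s) : ∃ C : ℝ, 0 ≤ C ∧ ∀ y : ℝ, 0 < y → y ^ s * Real.exp (-y) ≤ C := by
  obtain ⟨N, hN⟩ := exists_nat_ge s
  refine ⟨1 + N.factorial, by positivity, fun y hy => ?_⟩
  have h1 : y ^ s ≤ 1 + y ^ N := by
    rcases le_total y 1 with h | h
    · have := Real.rpow_le_one hy.le h hs
      have : 0 ≤ y ^ N := by positivity
      linarith
    · have := Real.rpow_le_rpow_of_exponent_le h hN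
      rw [Real.rpow_natCast] at this
      linarith
  have h2 := Real.pow_div_factorial_le_exp y hy.le N
  have h3 : 1 ≤ Real.exp y := Real.one_le_exp hy.le
  have h4 : (0:ℝ) < N.factorial := by positivity
  rw [div_le_iff₀ h4] at h2
  rw [Real.exp_neg, ← div_eq_mul_inv, div_le_iff₀ (Real.exp_pos y)]
  nlinarith

lemma gs_bdd (s : ℝ) (hs : 0 ≤ s) : ∃ C : ℝ, 0 ≤ C ∧ ∀ x : ℝ, |gs s x| ≤ C := by
  obtain ⟨C, hC, h⟩ := rpow_exp_bdd s hs
  refine ⟨C, hC, fun x => ?_⟩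
  unfold gs
  split_ifs with hx
  · have := h x⁻¹ (by positivity)
    rw [Real.inv_rpow hx.le, ← Real.rpow_neg hx.le] at this
    rwa [abs_of_nonneg (by positivity)]
  · simpa using hC

lemma gs_hasDeriv (s : ℝ) (hs : 0 ≤ s) (x : ℝ) :
    HasDerivAt (gs s) (-s * gs (s + 1) x + gs (s + 2) x) x := by
  rcases lt_trichotomy x 0 with hx | hx | hx
  · have : (gs s) =ᶠ[nhds x] fun _ => 0 := by
      filter_upwards [Iio_mem_nhds hx] with y hy
      simp only [Set.mem_Iio] at hy
      simp [gs, not_lt.mpr hy.le]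
    refine HasDerivAt.congr_of_eventuallyEq ?_ this
    simpa [gs, not_lt.mpr hx.le] using hasDerivAt_const x (0:ℝ)
  · subst hx
    obtain ⟨C, hC, h⟩ := gs_bdd (s + 2) (by linarith)
    have key : ∀ y : ℝ, |gs s y| ≤ C * y ^ 2 := by
      intro y
      by_cases hy : 0 < y
      · have h1 : gs s y = gs (s + 2) y * y ^ 2 := by
          simp only [gs, hy, if_true]
          rw [show -(s + 2) = -s - (2:ℕ) by push_cast; ring, Real.rpow_sub_natCast hy.ne']
          field_simp
        rw [h1, abs_mul, abs_of_nonneg (sq_nonneg y)]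
        exact mul_le_mul_of_nonneg_right (h y) (sq_nonneg y)
      · simp only [gs, hy, if_false, abs_zero]; positivity
    have h0 : gs s 0 = 0 := by simp [gs]
    have e : -s * gs (s + 1) 0 + gs (s + 2) 0 = 0 := by simp [gs]
    rw [e, hasDerivAt_iff_isLittleO, Asymptotics.isLittleO_iff]
    intro c hc
    have : ∀ᶠ y : ℝ in nhds 0, C * |y| < c := by
      have : Filter.Tendsto (fun y : ℝ => C * |y|) (nhds 0) (nhds (C * |0|)) := by
        apply Continuous.tendsto; fun_prop
      rw [abs_zero, mul_zero] at this
      exact this.eventually (gt_mem_nhds hc)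
    filter_upwards [this] with y hy
    simp only [h0, sub_zero, smul_zero, Real.norm_eq_abs]
    refine (key y).trans ?_
    rw [← sq_abs y]
    nlinarith [abs_nonneg y]
  · have : (gs s) =ᶠ[nhds x] fun y => y ^ (-s) * Real.exp (-y⁻¹) := by
      filter_upwards [Ioi_mem_nhds hx] with y hy
      simp only [Set.mem_Ioi] at hy
      simp [gs, hy]
    refine HasDerivAt.congr_of_eventuallyEq ?_ this
    have h1 := Real.hasDerivAt_rpow_const (x := x) (p := -s) (Or.inl hx.ne')
    have h2 := (hasDerivAt_inv hx.ne').fun_neg.exp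
    refine (h1.mul h2).congr_deriv ?_
    simp only [gs, hx, if_true]
    rw [show -(s + 2) = -s - (2:ℕ) by push_cast; ring, Real.rpow_sub_natCast hx.ne', show -(s+1) = -s-1 by ring]
    field_simp

lemma gs_smooth (n : ℕ) : ∀ s : ℝ, 0 ≤ s → ContDiff ℝ n (gs s) ∧
    ∃ C : ℝ, 0 ≤ C ∧ ∀ x, |iteratedDeriv n (gs s) x| ≤ C := by
  induction n with
  | zero =>
    intro s hs
    refine ⟨?_, ?_⟩
    · have : Continuous (gs s) := continuous_iff_continuousAt.mpr fun x => (gs_hasDeriv s hs x).continuousAt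
      simpa using this
    · simpa using gs_bdd s hs
  | succ n ih =>
    intro s hs
    have hd : deriv (gs s) = fun x => -s * gs (s + 1) x + gs (s + 2) x := by
      funext x; exact (gs_hasDeriv s hs x).deriv
    obtain ⟨a1, C1, c1, b1⟩ := ih (s + 1) (by linarith)
    obtain ⟨a2, C2, c2, b2⟩ := ih (s + 2) (by linarith)
    refine ⟨?_, ?_⟩
    · have := (contDiff_succ_iff_deriv (𝕜 := ℝ) (n := n) (f := gs s)).mpr
        ⟨fun x => (gs_hasDeriv s hs x).differentiableAt, by simp, by
          rw [hd]; exact (contDiff_const.mul a1).add a2⟩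
      exact_mod_cast this
    · refine ⟨s * C1 + C2, by positivity, fun x => ?_⟩
      rw [iteratedDeriv_succ', hd]
      have e : iteratedDeriv n (fun x => -s * gs (s + 1) x + gs (s + 2) x) x =
          -s * iteratedDeriv n (gs (s + 1)) x + iteratedDeriv n (gs (s + 2)) x := by
        have := iteratedDeriv_fun_add (x := x) (n := n) (f := fun x => -s * gs (s + 1) x) (g := gs (s + 2))
          (contDiff_const.mul a1).contDiffAt a2.contDiffAt
        rw [this, iteratedDeriv_const_mul _ a1.contDiffAt]
      rw [e]
      refine (abs_add_le _ _).trans ?_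
      rw [abs_mul, abs_neg, abs_of_nonneg hs]
      gcongr
      · exact b1 x
      · exact b2 x

lemma dchi_abs (n : ℕ) : |(dchi n : ℝ)| ≤ 1 := by
  unfold dchi; split_ifs <;> simp

lemma dchi_zero : dchi 0 = 0 := by decide

lemma smooth_series :
    ContDiff ℝ (⊤ : ℕ∞) (fun x : ℝ => ∑' n : ℕ, (dchi n : ℝ) * ((n : ℝ) ^ 2)⁻¹ * gs (3 / 2) (((n : ℝ) ^ 2)⁻¹ * x)) := by
  choose h1 C hC h2 using fun n : ℕ => gs_smooth n (3 / 2) (by norm_num)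
  refine contDiff_tsum (𝕜 := ℝ) (N := ⊤) (f := fun (n : ℕ) (x : ℝ) => (dchi n : ℝ) * ((n : ℝ) ^ 2)⁻¹ * gs (3 / 2) (((n : ℝ) ^ 2)⁻¹ * x))
    (v := fun k n => C k * ((n : ℝ) ^ 2)⁻¹) ?_ ?_ ?_
  · intro n
    have : ContDiff ℝ (⊤ : ℕ∞) (gs (3/2)) := contDiff_infty.mpr h1
    exact contDiff_const.mul (this.comp (contDiff_const.mul contDiff_id))
  · intro k _
    exact (Real.summable_nat_pow_inv.mpr (by norm_num)).mul_left _
  · intro k n x _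
    rw [norm_iteratedFDeriv_eq_norm_iteratedDeriv, Real.norm_eq_abs]
    rw [iteratedDeriv_const_mul (x := x) (n := k) (f := fun x : ℝ => gs (3 / 2) (((n : ℝ) ^ 2)⁻¹ * x)) _
      ((h1 k).comp (contDiff_const.mul contDiff_id)).contDiffAt]
    rw [iteratedDeriv_comp_const_mul (h1 k)]
    rcases Nat.eq_zero_or_pos n with rfl | hn
    · simp [dchi_zero]
    · have hn1 : (1:ℝ) ≤ n := by exact_mod_cast hn
      have h3 : |(((n : ℝ) ^ 2)⁻¹) ^ k| ≤ 1 := by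
        rw [abs_of_nonneg (by positivity)]
        exact pow_le_one₀ (by positivity) (inv_le_one_of_one_le₀ (one_le_pow₀ hn1))
      rw [abs_mul, abs_mul, abs_mul, abs_of_nonneg (show (0:ℝ) ≤ ((n : ℝ) ^ 2)⁻¹ by positivity)]
      calc _ ≤ 1 * ((n : ℝ) ^ 2)⁻¹ * (1 * C k) := by
            gcongr
            · exact dchi_abs n
            · exact h2 k _
        _ = _ := by ring

lemma sin_dchi (n : ℕ) : Real.sin (2 * π * (1 / 4 : ℝ) * n) = dchi n := by
  have hn : (n : ℝ) = 4 * (n / 4 : ℕ) + (n % 4 : ℕ) := by exact_mod_cast (Nat.div_add_mod n 4).symm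
  rw [hn, show 2 * π * (1 / 4 : ℝ) * (4 * (n / 4 : ℕ) + (n % 4 : ℕ)) = (n % 4 : ℕ) * (π / 2) + (n / 4 : ℕ) * (2 * π) by ring,
    Real.sin_add_nat_mul_two_pi]
  have : n % 4 < 4 := Nat.mod_lt _ (by norm_num)
  unfold dchi
  interval_cases n % 4
  · simp
  · simp
  · simp [show (2:ℝ) * (π / 2) = π by ring]
  · simp only [Nat.cast_ofNat]
    rw [show (3:ℝ) * (π / 2) = π / 2 + π by ring, Real.sin_add_pi]; simp

lemma pair_hasSum (f : ℕ → ℝ) (S : ℝ) (h : HasSum (fun n => (dchi n : ℝ) * f n) S) :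
    HasSum (fun k : ℕ => f (4 * k + 1) - f (4 * k + 3)) S := by
  have h1 := (Nat.divModEquiv 4).symm.hasSum_iff.mpr h
  refine (h1.prod_fiberwise (g := fun k : ℕ => f (4 * k + 1) - f (4 * k + 3)) fun k => ?_)
  have := hasSum_fintype (fun c : Fin 4 => ((fun n => (dchi n : ℝ) * f n) ∘ (Nat.divModEquiv 4).symm) (k, c))
  convert! this using 1
  rw [Fin.sum_univ_four]
  have e (j : ℕ) (hj : j < 4) : dchi (k * 4 + j) = dchi j := by
    unfold dchi; rw [show (k * 4 + j) % 4 = j % 4 by omega]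
  simp [Nat.divModEquiv]
  rw [show dchi (k * 4) = 0 by unfold dchi; simp, e 1 (by omega), e 2 (by omega), e 3 (by omega)]
  simp [dchi]; ring_nf

noncomputable def FF (a : ℝ) : ℝ := ∑' n : ℕ, (dchi n : ℝ) * (n : ℝ) * Real.exp (-(a * (n : ℝ) ^ 2))

lemma FF_hasSum {a : ℝ} (ha : 0 < a) :
    HasSum (fun n : ℕ => (dchi n : ℝ) * (n : ℝ) * Real.exp (-(a * (n : ℝ) ^ 2))) (FF a) := by
  have := (HurwitzZeta.hasSum_nat_sinKernel (1 / 4) (t := a / π) (by positivity)).mul_left (1 / 2)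
  refine Summable.hasSum (this.summable.congr fun n => ?_)
  rw [sin_dchi, show -π * (n:ℝ) ^ 2 * (a / π) = -(a * (n : ℝ) ^ 2) by field_simp]; ring

lemma FF_sin {a : ℝ} (ha : 0 < a) : HurwitzZeta.sinKernel ((1 / 4 : ℝ) : UnitAddCircle) (a / π) = 2 * FF a := by
  refine (HurwitzZeta.hasSum_nat_sinKernel (1 / 4) (t := a / π) (by positivity)).unique ?_
  refine ((FF_hasSum ha).mul_left 2).congr_fun fun n => ?_
  rw [sin_dchi, show -π * (n:ℝ) ^ 2 * (a / π) = -(a * (n : ℝ) ^ 2) by field_simp]; ring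

lemma FF_pair {a : ℝ} (ha : 0 < a) : HasSum (fun k : ℕ => ((4 * k + 1 : ℕ) : ℝ) * Real.exp (-(a * ((4 * k + 1 : ℕ) : ℝ) ^ 2))
    - ((4 * k + 3 : ℕ) : ℝ) * Real.exp (-(a * ((4 * k + 3 : ℕ) : ℝ) ^ 2))) (FF a) := by
  refine pair_hasSum (fun n => (n : ℝ) * Real.exp (-(a * (n : ℝ) ^ 2))) _ ?_
  simpa only [mul_assoc] using FF_hasSum ha

lemma FF_odd {a : ℝ} (ha : 0 < a) : HurwitzZeta.oddKernel ((1 / 4 : ℝ) : UnitAddCircle) (16 * a / π) = FF a / 4 := by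
  have := (HurwitzZeta.hasSum_int_oddKernel (1 / 4) (x := 16 * a / π) (by positivity)).nat_add_neg_add_one
  refine this.unique (((FF_pair ha).div_const 4).congr_fun fun k => ?_)
  push_cast
  rw [show -π * ((k:ℝ) + 1 / 4) ^ 2 * (16 * a / π) = -(a * (4 * (k:ℝ) + 1) ^ 2) by field_simp; ring,
    show -π * (-((k:ℝ) + 1) + 1 / 4) ^ 2 * (16 * a / π) = -(a * (4 * (k:ℝ) + 3) ^ 2) by field_simp; ring]
  ring

lemma FF_feq {x : ℝ} (hx : 0 < x) : (π / 8) * FF (π ^ 2 * x / 16) = (√π)⁻¹ * (x ^ (-(3 / 2) : ℝ) * FF (x⁻¹)) := by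
  have h1 := FF_odd (a := π ^ 2 * x / 16) (by positivity)
  have h2 := FF_sin (a := x⁻¹) (by positivity)
  have h3 := HurwitzZeta.oddKernel_functional_equation ((1 / 4 : ℝ) : UnitAddCircle) (π * x)
  rw [show 16 * (π ^ 2 * x / 16) / π = π * x by field_simp] at h1
  rw [show x⁻¹ / π = 1 / (π * x) by field_simp] at h2
  rw [h1, h2, Real.mul_rpow pi_pos.le hx.le] at h3
  have h4 : π ^ (3 / 2 : ℝ) = π * √π := by
    rw [show (3 / 2 : ℝ) = 1 + 1 / 2 by norm_num, Real.rpow_add pi_pos, Real.rpow_one, Real.sqrt_eq_rpow]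
  rw [h4] at h3
  rw [Real.rpow_neg hx.le]
  have : FF (π ^ 2 * x / 16) = 8 * (1 / (π * √π * x ^ (3 / 2 : ℝ)) * FF x⁻¹) := by linarith
  rw [this]
  field_simp

lemma FF_pos_of_ge {a : ℝ} (ha : 1 / 2 ≤ a) : 0 < FF a := by
  have key : ∀ k : ℕ, 0 < ((4 * k + 1 : ℕ) : ℝ) * Real.exp (-(a * ((4 * k + 1 : ℕ) : ℝ) ^ 2))
    - ((4 * k + 3 : ℕ) : ℝ) * Real.exp (-(a * ((4 * k + 3 : ℕ) : ℝ) ^ 2)) := by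
    intro k
    push_cast
    set n : ℝ := 4 * (k:ℝ) + 1 with hn
    have hn1 : 1 ≤ n := by have : (0:ℝ) ≤ k := by positivity
                           linarith
    rw [show 4 * (k:ℝ) + 3 = n + 2 by rw [hn]; ring]
    rw [show -(a * n ^ 2) = -(a * (n + 2) ^ 2) + a * (4 * n + 4) by ring, Real.exp_add]
    have h1 := Real.add_one_le_exp (a * (4 * n + 4))
    have h2 : 4 ≤ a * (4 * n + 4) := by nlinarith
    have h3 : n + 2 < n * Real.exp (a * (4 * n + 4)) := by nlinarith
    have := Real.exp_pos (-(a * (n + 2) ^ 2))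
    nlinarith
  have hs := FF_pair (a := a) (by linarith)
  rw [← hs.tsum_eq]
  exact hs.summable.tsum_pos (fun k => (key k).le) 0 (key 0)

lemma phi_eq {x : ℝ} (hx : 0 < x) : phi x = (π / 8) * FF (π ^ 2 * x / 16) := by
  rw [phi, if_pos hx, FF]
  congr 1
  refine tsum_congr fun n => ?_
  congr 2
  ring

lemma phi_pos {x : ℝ} (hx : 0 < x) : 0 < phi x := by
  rw [phi_eq hx]
  rcases le_total 1 x with h | h
  · have : 0 < FF (π ^ 2 * x / 16) := FF_pos_of_ge (by nlinarith [Real.pi_gt_three])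
    positivity
  · rw [FF_feq hx]
    have : 0 < FF (x⁻¹) := FF_pos_of_ge (by have := one_le_inv_iff₀.mpr ⟨hx, h⟩; linarith)
    positivity

lemma phi_series : phi = fun x => (√π)⁻¹ * ∑' n : ℕ, (dchi n : ℝ) * ((n : ℝ) ^ 2)⁻¹ * gs (3 / 2) (((n : ℝ) ^ 2)⁻¹ * x) := by
  funext x
  by_cases hx : 0 < x
  · rw [phi_eq hx, FF_feq hx, FF, ← tsum_mul_left]
    congr 1
    refine tsum_congr fun n => ?_
    rcases Nat.eq_zero_or_pos n with rfl | hn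
    · simp [dchi_zero]
    · have hn0 : (0:ℝ) < n := by exact_mod_cast hn
      have hp : 0 < ((n : ℝ) ^ 2)⁻¹ * x := by positivity
      simp only [gs, hp, if_true]
      rw [Real.mul_rpow (by positivity) hx.le]
      have : (((n : ℝ) ^ 2)⁻¹) ^ (-(3 / 2) : ℝ) = (n:ℝ) ^ 3 := by
        rw [Real.inv_rpow (by positivity), ← Real.rpow_neg (by positivity), neg_neg, ← Real.rpow_natCast, ← Real.rpow_mul hn0.le,
          ← Real.rpow_natCast]
        norm_num
      rw [this, show (((n : ℝ) ^ 2)⁻¹ * x)⁻¹ = x⁻¹ * (n:ℝ) ^ 2 by field_simp]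
      field_simp
  · rw [phi, if_neg hx]
    have : ∀ n : ℕ, gs (3 / 2) (((n : ℝ) ^ 2)⁻¹ * x) = 0 := by
      intro n
      rw [gs, if_neg]
      push Not
      exact mul_nonpos_of_nonneg_of_nonpos (by positivity) (not_lt.mp hx)
    simp [this]

lemma phi_smooth : ContDiff ℝ (⊤ : ℕ∞) phi := by
  rw [phi_series]; exact ContDiff.mul contDiff_const smooth_series

noncomputable def Tc (c : ℕ → ℝ) (x : ℝ) : ℝ := ∑' n : ℕ, c n * Real.exp (-(π ^ 2 * (n : ℝ) ^ 2 * x) / 16)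

lemma pow_exp_summable (K : ℝ) (p : ℕ) {x : ℝ} (hx : 0 < x) :
    Summable fun n : ℕ => K * (n : ℝ) ^ p * Real.exp (-(π ^ 2 * (n : ℝ) ^ 2 * x) / 16) := by
  have h := Real.summable_pow_mul_exp_neg_nat_mul p (r := π ^ 2 * x / 16) (by positivity)
  have h2 : Summable fun n : ℕ => (n : ℝ) ^ p * Real.exp (-(π ^ 2 * (n : ℝ) ^ 2 * x) / 16) := by
    refine Summable.of_nonneg_of_le (fun n => by positivity) (fun n => ?_) h
    gcongr
    have : (n : ℝ) ≤ (n : ℝ) ^ 2 := by exact_mod_cast Nat.le_self_pow (by norm_num) n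
    have h3 : 0 < π ^ 2 * x / 16 := by positivity
    nlinarith
  simpa only [mul_assoc] using h2.mul_left K

lemma term_le (c : ℕ → ℝ) (K : ℝ) (p : ℕ) (hc : ∀ n, |c n| ≤ K * (n : ℝ) ^ p) (n : ℕ) {x y : ℝ} (h : x ≤ y) :
    ‖c n * Real.exp (-(π ^ 2 * (n : ℝ) ^ 2 * y) / 16)‖ ≤
      K * (n : ℝ) ^ p * Real.exp (-(π ^ 2 * (n : ℝ) ^ 2 * x) / 16) := by
  rw [norm_mul, Real.norm_eq_abs, Real.norm_eq_abs, Real.abs_exp]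
  have h1 : 0 ≤ K * (n : ℝ) ^ p := (abs_nonneg _).trans (hc n)
  have := hc n
  gcongr

lemma Tc_summable (c : ℕ → ℝ) (K : ℝ) (p : ℕ) (hc : ∀ n, |c n| ≤ K * (n : ℝ) ^ p) {x : ℝ} (hx : 0 < x) :
    Summable fun n : ℕ => c n * Real.exp (-(π ^ 2 * (n : ℝ) ^ 2 * x) / 16) :=
  (pow_exp_summable K p hx).of_norm_bounded fun n => term_le c K p hc n le_rfl

lemma shift_bound (c : ℕ → ℝ) (K : ℝ) (p : ℕ) (hc : ∀ n, |c n| ≤ K * (n : ℝ) ^ p) (n : ℕ) :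
    |-(π ^ 2 * (n : ℝ) ^ 2 / 16) * c n| ≤ (π ^ 2 / 16 * K) * (n : ℝ) ^ (p + 2) := by
  rw [abs_mul, abs_neg, abs_of_nonneg (show 0 ≤ π ^ 2 * (n : ℝ) ^ 2 / 16 by positivity)]
  calc _ ≤ π ^ 2 * (n : ℝ) ^ 2 / 16 * (K * (n : ℝ) ^ p) := by gcongr; exact hc n
    _ = _ := by ring

lemma Tc_deriv (c : ℕ → ℝ) (K : ℝ) (p : ℕ) (hc : ∀ n, |c n| ≤ K * (n : ℝ) ^ p) {x : ℝ} (hx : 0 < x) :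
    HasDerivAt (Tc c) (Tc (fun n => -(π ^ 2 * (n : ℝ) ^ 2 / 16) * c n) x) x := by
  have hx2 : 0 < x / 2 := by positivity
  refine hasDerivAt_tsum_of_isPreconnected (t := Set.Ioi (x / 2)) (y₀ := x)
    (g := fun (n : ℕ) (x : ℝ) => c n * Real.exp (-(π ^ 2 * (n : ℝ) ^ 2 * x) / 16))
    (g' := fun (n : ℕ) (x : ℝ) => -(π ^ 2 * (n : ℝ) ^ 2 / 16) * c n * Real.exp (-(π ^ 2 * (n : ℝ) ^ 2 * x) / 16))
    (pow_exp_summable (π ^ 2 / 16 * K) (p + 2) hx2) isOpen_Ioi isPreconnected_Ioi ?_ ?_ ?_ (Tc_summable c K p hc hx) ?_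
  · intro n y _
    have h1 : HasDerivAt (fun y : ℝ => -(π ^ 2 * (n : ℝ) ^ 2 * y) / 16) (-(π ^ 2 * (n : ℝ) ^ 2 * 1) / 16) y :=
      (((hasDerivAt_id y).const_mul _).fun_neg).div_const 16
    refine (h1.exp.const_mul (c n)).congr_deriv ?_
    ring
  · intro n y hy
    exact term_le _ _ _ (shift_bound c K p hc) n (le_of_lt hy)
  · simpa using hx
  · simpa using hx

lemma Tc_decay (c : ℕ → ℝ) (K : ℝ) (p : ℕ) (hc : ∀ n, |c n| ≤ K * (n : ℝ) ^ p) (h0 : c 0 = 0) :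
    ∃ M : ℝ, ∀ x : ℝ, 1 ≤ x → |Tc c x| ≤ M * Real.exp (-(π ^ 2 / 16 * x)) := by
  refine ⟨(∑' n : ℕ, K * (n : ℝ) ^ p * Real.exp (-(π ^ 2 * (n : ℝ) ^ 2 * 1) / 16)) * Real.exp (π ^ 2 / 16), fun x hx => ?_⟩
  have hs := pow_exp_summable K p one_pos
  rw [mul_assoc, ← Real.exp_add, ← Real.norm_eq_abs, Tc]
  refine tsum_of_norm_bounded (hs.hasSum.mul_right _) fun n => ?_
  rcases Nat.eq_zero_or_pos n with rfl | hn
  · have := (abs_nonneg _).trans (hc 0)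
    simp only [h0, zero_mul, norm_zero]
    exact mul_nonneg (mul_nonneg this (Real.exp_pos _).le) (Real.exp_pos _).le
  · rw [norm_mul, Real.norm_eq_abs, Real.norm_eq_abs, Real.abs_exp, mul_assoc (K * (n : ℝ) ^ p), ← Real.exp_add]
    have h1 : 0 ≤ K * (n : ℝ) ^ p := (abs_nonneg _).trans (hc n)
    have h2 := hc n
    gcongr
    have hn1 : (1:ℝ) ≤ (n:ℝ) ^ 2 := one_le_pow₀ (by exact_mod_cast hn)
    have : 0 ≤ π ^ 2 / 16 * (((n:ℝ) ^ 2 - 1) * (x - 1)) :=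
      mul_nonneg (by positivity) (mul_nonneg (by linarith) (by linarith))
    nlinarith

lemma iter_phi (k : ℕ) : ∃ c : ℕ → ℝ, ∃ K : ℝ, ∃ p : ℕ, (∀ n, |c n| ≤ K * (n : ℝ) ^ p) ∧ c 0 = 0 ∧
    ∀ x : ℝ, 0 < x → iteratedDeriv k phi x = Tc c x := by
  induction k with
  | zero =>
    refine ⟨fun n => π / 8 * ((dchi n : ℝ) * n), π / 8, 1, fun n => ?_, by simp, fun x hx => ?_⟩
    · rw [abs_mul, abs_mul, abs_of_nonneg (show 0 ≤ π / 8 by positivity), Nat.abs_cast, pow_one]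
      have := mul_le_mul_of_nonneg_right (dchi_abs n) (Nat.cast_nonneg (α := ℝ) n)
      rw [one_mul] at this
      gcongr
    · rw [iteratedDeriv_zero, phi, if_pos hx, Tc, ← tsum_mul_left]
      simp only [mul_assoc]
  | succ k ih =>
    obtain ⟨c, K, p, hc, h0, h⟩ := ih
    refine ⟨fun n => -(π ^ 2 * (n : ℝ) ^ 2 / 16) * c n, π ^ 2 / 16 * K, p + 2, shift_bound c K p hc, by simp, fun x hx => ?_⟩
    rw [iteratedDeriv_succ, ← (Tc_deriv c K p hc hx).deriv]
    apply Filter.EventuallyEq.deriv_eq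
    filter_upwards [Ioi_mem_nhds hx] with y hy using h y hy

lemma phi_schwartz (m k : ℕ) : ∃ M : ℝ, ∀ x : ℝ, |x| ^ m * |iteratedDeriv k phi x| ≤ M := by
  obtain ⟨c, K, p, hc, h0, h⟩ := iter_phi k
  obtain ⟨M, hM⟩ := Tc_decay c K p hc h0
  have hcont : Continuous (fun x : ℝ => |x| ^ m * |iteratedDeriv k phi x|) := by
    have := phi_smooth.continuous_iteratedDeriv k (by exact_mod_cast le_top)
    fun_prop
  obtain ⟨A, hA⟩ := (isCompact_Icc (a := (-1:ℝ)) (b := 1)).bddAbove_image hcont.continuousOn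
  have hA' : ∀ x : ℝ, -1 ≤ x → x ≤ 1 → |x| ^ m * |iteratedDeriv k phi x| ≤ A := fun x h1 h2 =>
    hA (Set.mem_image_of_mem _ ⟨h1, h2⟩)
  have hA0 : 0 ≤ A := le_trans (by positivity) (hA' 0 (by norm_num) (by norm_num))
  obtain ⟨B, hB0, hB⟩ := rpow_exp_bdd m (by positivity)
  have hB' : ∀ x : ℝ, 0 < x → x ^ m * Real.exp (-(π ^ 2 / 16 * x)) ≤ B / (π ^ 2 / 16) ^ m := by
    intro x hx
    have := hB (π ^ 2 / 16 * x) (by positivity)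
    rw [Real.rpow_natCast, mul_pow] at this
    rw [le_div_iff₀ (by positivity)]
    linarith
  refine ⟨A + |M| * (B / (π ^ 2 / 16) ^ m), fun x => ?_⟩
  have hMB : 0 ≤ |M| * (B / (π ^ 2 / 16) ^ m) := by positivity
  rcases lt_or_ge x (-1) with hx | hx
  · have : iteratedDeriv k phi x = 0 := by
      have e : phi =ᶠ[nhds x] fun _ => (0:ℝ) := by
        filter_upwards [Iio_mem_nhds (show x < 0 by linarith)] with y hy
        rw [phi, if_neg (not_lt.mpr (le_of_lt hy))]
      rw [e.iteratedDeriv_eq k, iteratedDeriv_const]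
      simp
    rw [this, abs_zero, mul_zero]; positivity
  · rcases le_or_gt x 1 with hx1 | hx1
    · have := hA' x hx hx1; linarith
    · have hx0 : 0 < x := by linarith
      have h1 := hM x hx1.le
      rw [h x hx0, abs_of_pos hx0]
      have h2 := hB' x hx0
      calc x ^ m * |Tc c x| ≤ x ^ m * (|M| * Real.exp (-(π ^ 2 / 16 * x))) := by
            gcongr
            exact h1.trans (mul_le_mul_of_nonneg_right (le_abs_self M) (Real.exp_pos _).le)
        _ = |M| * (x ^ m * Real.exp (-(π ^ 2 / 16 * x))) := by ring
        _ ≤ |M| * (B / (π ^ 2 / 16) ^ m) := by gcongr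
        _ ≤ _ := by linarith

noncomputable def Pp (x : ℝ) : ℝ := ∑' k : ℕ, (((4 * k + 1 : ℕ) : ℝ)⁻¹ * Real.exp (-(π ^ 2 * ((4 * k + 1 : ℕ) : ℝ) ^ 2 * x) / 16)
  - ((4 * k + 3 : ℕ) : ℝ)⁻¹ * Real.exp (-(π ^ 2 * ((4 * k + 3 : ℕ) : ℝ) ^ 2 * x) / 16))

lemma dinv_bound (n : ℕ) : |(dchi n : ℝ) * (n : ℝ)⁻¹| ≤ 1 * (n : ℝ) ^ 0 := by
  rw [abs_mul, pow_zero, one_mul, abs_of_nonneg (show (0:ℝ) ≤ (n:ℝ)⁻¹ by positivity)]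
  exact mul_le_one₀ (dchi_abs n) (by positivity) (Nat.cast_inv_le_one n)

lemma Pp_eq {x : ℝ} (hx : 0 < x) : Pp x = Tc (fun n => (dchi n : ℝ) * (n : ℝ)⁻¹) x := by
  have h := (Tc_summable _ _ _ dinv_bound hx).hasSum
  simp only [mul_assoc] at h
  have := pair_hasSum (fun n => (n : ℝ)⁻¹ * Real.exp (-(π ^ 2 * (n : ℝ) ^ 2 * x) / 16)) _
    (by simpa only [mul_assoc] using h)
  rw [Pp, this.tsum_eq, Tc]
  simp only [mul_assoc]

lemma pair_bound (k : ℕ) {x : ℝ} (hx : 0 ≤ x) :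
    ‖((4 * k + 1 : ℕ) : ℝ)⁻¹ * Real.exp (-(π ^ 2 * ((4 * k + 1 : ℕ) : ℝ) ^ 2 * x) / 16)
  - ((4 * k + 3 : ℕ) : ℝ)⁻¹ * Real.exp (-(π ^ 2 * ((4 * k + 3 : ℕ) : ℝ) ^ 2 * x) / 16)‖ ≤ 6 * (((k + 1 : ℕ) : ℝ) ^ 2)⁻¹ := by
  have hk0 : (0:ℝ) ≤ k := by positivity
  push_cast
  set n : ℝ := 4 * (k:ℝ) + 1 with hn
  have hn1 : 1 ≤ n := by linarith
  rw [show 4 * (k:ℝ) + 3 = n + 2 by rw [hn]; ring]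
  set b : ℝ := π ^ 2 * x / 16 with hb
  have hb0 : 0 ≤ b := by positivity
  rw [show -(π ^ 2 * n ^ 2 * x) / 16 = -(b * n ^ 2) by rw [hb]; ring,
    show -(π ^ 2 * (n + 2) ^ 2 * x) / 16 = -(b * n ^ 2) + -(b * (4 * n + 4)) by rw [hb]; ring, Real.exp_add]
  set E := Real.exp (-(b * n ^ 2)) with hE
  set G := Real.exp (-(b * (4 * n + 4))) with hG
  have E0 : 0 < E := Real.exp_pos _
  have G0 : 0 < G := Real.exp_pos _
  have E1 : E ≤ 1 := Real.exp_le_one_iff.mpr (by have : 0 ≤ b * n ^ 2 := by positivity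
                                                 linarith)
  have G1 : G ≤ 1 := Real.exp_le_one_iff.mpr (by have : 0 ≤ b * (4 * n + 4) := by positivity
                                                 linarith)
  have G2 : 1 - G ≤ b * (4 * n + 4) := by
    have := Real.add_one_le_exp (-(b * (4 * n + 4)))
    linarith
  have E2 : E * (b * n ^ 2) ≤ 1 := by
    rw [hE, Real.exp_neg, inv_mul_le_iff₀ (Real.exp_pos _), mul_one]
    have := Real.add_one_le_exp (b * n ^ 2)
    linarith
  have n0 : 0 < n := by linarith
  have eq : n⁻¹ * E - (n + 2)⁻¹ * (E * G) = E * (2 / (n * (n + 2))) + E * (1 - G) / (n + 2) := by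
    field_simp; ring
  have nn : 0 ≤ E * (2 / (n * (n + 2))) + E * (1 - G) / (n + 2) := by
    have : 0 ≤ 1 - G := by linarith
    positivity
  rw [eq, Real.norm_of_nonneg nn]
  have u1 : E * (2 / (n * (n + 2))) ≤ 2 / n ^ 2 := by
    calc _ ≤ 1 * (2 / (n * (n + 2))) := by gcongr
      _ = 2 / (n * (n + 2)) := one_mul _
      _ ≤ 2 / n ^ 2 := by gcongr; nlinarith
  have u2 : E * (1 - G) / (n + 2) ≤ 4 / n ^ 2 := by
    rw [div_le_div_iff₀ (by positivity) (by positivity)]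
    calc E * (1 - G) * n ^ 2 ≤ E * (b * (4 * n + 4)) * n ^ 2 := by gcongr
      _ = (E * (b * n ^ 2)) * (4 * n + 4) := by ring
      _ ≤ 1 * (4 * n + 4) := by gcongr
      _ ≤ _ := by linarith
  have u3 : 6 / n ^ 2 ≤ 6 * (((k:ℝ) + 1) ^ 2)⁻¹ := by
    rw [← div_eq_mul_inv]; gcongr; linarith
  have : 6 / n ^ 2 = 2 / n ^ 2 + 4 / n ^ 2 := by ring
  linarith

lemma bound_summable : Summable fun k : ℕ => 6 * (((k + 1 : ℕ) : ℝ) ^ 2)⁻¹ :=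
  ((summable_nat_add_iff 1).mpr (Real.summable_nat_pow_inv.mpr (by norm_num : 1 < 2))).mul_left 6

lemma Pp_cont : ContinuousWithinAt Pp (Set.Ici 0) 0 := by
  refine tendsto_tsum_of_dominated_convergence bound_summable (fun k => ?_) ?_
  · apply ContinuousWithinAt.tendsto
    apply Continuous.continuousWithinAt
    fun_prop
  · filter_upwards [self_mem_nhdsWithin] with x hx k using pair_bound k hx

lemma Pp_zero : Pp 0 = π / 4 := by
  have hs : Summable fun k : ℕ => (((4 * k + 1 : ℕ) : ℝ)⁻¹ * Real.exp (-(π ^ 2 * ((4 * k + 1 : ℕ) : ℝ) ^ 2 * 0) / 16)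
    - ((4 * k + 3 : ℕ) : ℝ)⁻¹ * Real.exp (-(π ^ 2 * ((4 * k + 3 : ℕ) : ℝ) ^ 2 * 0) / 16)) :=
    bound_summable.of_norm_bounded fun k => pair_bound k le_rfl
  have h1 := hs.hasSum.tendsto_sum_nat
  have h2 := Real.tendsto_sum_pi_div_four.comp (Filter.tendsto_id.const_mul_atTop' (show 0 < 2 by norm_num))
  refine tendsto_nhds_unique h1 (h2.congr fun N => ?_)
  simp only [Function.comp, id]
  induction N with
  | zero => simp
  | succ N ih =>
    rw [show 2 * (N + 1) = 2 * N + 1 + 1 by ring, Finset.sum_range_succ, Finset.sum_range_succ, ih, Finset.sum_range_succ]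
    simp [pow_succ, pow_mul]
    ring_nf

lemma phi_integral : (∫ x : ℝ, phi x) = 1 / 2 := by
  have h1 : (∫ x : ℝ, phi x) = ∫ x in Set.Ioi 0, phi x := by
    rw [← MeasureTheory.integral_indicator measurableSet_Ioi]
    congr 1
    funext x
    by_cases hx : 0 < x
    · simp [Set.indicator, hx]
    · simp [Set.indicator, hx, phi]
  have h2 := integral_Ioi_of_hasDerivAt_of_nonneg (a := 0) (l := 0) (g := fun x => -(2 / π) * Pp x) (g' := phi)
    (continuousWithinAt_const.mul Pp_cont) ?_ (fun x hx => (phi_pos hx).le) ?_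
  · rw [h1, h2, Pp_zero]; field_simp; norm_num
  · intro x hx
    have hx' : 0 < x := hx
    have e : Pp =ᶠ[nhds x] Tc (fun n => (dchi n : ℝ) * (n : ℝ)⁻¹) := by
      filter_upwards [Ioi_mem_nhds hx'] with y hy using Pp_eq hy
    refine (((Tc_deriv _ _ _ dinv_bound hx').congr_of_eventuallyEq e).const_mul (-(2 / π))).congr_deriv ?_
    rw [Tc, phi, if_pos hx', ← tsum_mul_left, ← tsum_mul_left]
    refine tsum_congr fun n => ?_
    rcases Nat.eq_zero_or_pos n with rfl | hn
    · simp [dchi_zero]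
    · have hn0 : (n:ℝ) ≠ 0 := by positivity
      field_simp
      ring
  · obtain ⟨M, hM⟩ := Tc_decay _ _ _ dinv_bound (by simp)
    have t1 : Filter.Tendsto (fun x : ℝ => M * Real.exp (-(π ^ 2 / 16 * x))) Filter.atTop (nhds (M * 0)) := by
      refine Filter.Tendsto.const_mul _ (Real.tendsto_exp_neg_atTop_nhds_zero.comp ?_)
      exact Filter.tendsto_id.const_mul_atTop (by positivity)
    rw [mul_zero] at t1
    have t2 : Filter.Tendsto Pp Filter.atTop (nhds 0) := by
      refine squeeze_zero_norm' ?_ t1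
      filter_upwards [Filter.eventually_ge_atTop 1] with x hx
      rw [Pp_eq (by linarith)]
      exact hM x hx
    simpa using t2.const_mul (-(2 / π))

theorem phi_is_schwartz_positive_half :
    ContDiff ℝ (⊤ : ℕ∞) phi ∧
      (∀ m k : ℕ, ∃ M : ℝ, ∀ x : ℝ, |x| ^ m * |iteratedDeriv k phi x| ≤ M) ∧
      (∀ x : ℝ, 0 < x → 0 < phi x) ∧
      (∫ x : ℝ, phi x) = 1 / 2 := by
  exact ⟨phi_smooth, phi_schwartz, fun x hx => phi_pos hx, phi_integral⟩
end

section
/- Define A_s : ℤ → ℝ by A_s(k) = 4^{−k}·(x (2^s) k) for k ≥ 0 and A_s(k) = 0 for k < 0. Then: (I) ∑_{k∈ℤ} A_s(k) = 1/2 for every s ∈ ℕ; (II) for every r ∈ ℕ there exists C_r such that A_s(k) ≤ C_r·4^{−s}·(4^s/k)^r for all s ∈ ℕ and all integers k > 0; (III) there exists C such that |A_s(k₁) − A_s(k₂)| ≤ C·(|k₁ − k₂|·16^{−s} + 8^{−s}) for all s ∈ ℕ and all k₁, k₂ ∈ ℤ. -/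
/-- `xfun n k` is the multiplicity of the indecomposable tilting module `T(2n)` in
`V^{⊗2k}`, where `V` is the natural representation of `SL₂` in characteristic 2. -/
def xfun : ℕ → ℕ → ℕ
  | 0, 0 => 1
  | 0, _ + 1 => 0
  | _ + 1, 0 => 0
  | n + 1, k + 1 =>
      xfun n k + 2 * ∑ i ∈ Finset.range ((n + 1).factorization 2 + 1), xfun (n + 2 ^ i) k

/-- `A_s(k) = 4^{−k}·x(2^s, k)` for `k ≥ 0`, and `0` for `k < 0`. -/
noncomputable def Aseq (s : ℕ) (k : ℤ) : ℝ :=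
  if 0 ≤ k then (4 : ℝ) ^ (-k) * (xfun (2 ^ s) k.toNat : ℝ) else 0

/-- Normalised generating function of `xfun n`. -/
noncomputable def Fser (n : ℕ) : PowerSeries ℝ := PowerSeries.mk fun k => (xfun n k : ℝ) / 4 ^ k

lemma coeff_two_mul_aux (k : ℕ) (p : PowerSeries ℝ) :
    PowerSeries.coeff k (2 * p) = 2 * PowerSeries.coeff k p := by
  have : (2 : PowerSeries ℝ) = PowerSeries.C 2 := (map_ofNat PowerSeries.C 2).symm
  rw [this, PowerSeries.coeff_C_mul]

lemma coeff_four_mul_aux (k : ℕ) (p : PowerSeries ℝ) :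
    PowerSeries.coeff k (4 * p) = 4 * PowerSeries.coeff k p := by
  have : (4 : PowerSeries ℝ) = PowerSeries.C 4 := (map_ofNat PowerSeries.C 4).symm
  rw [this, PowerSeries.coeff_C_mul]

lemma Fser_zero : Fser 0 = 1 := by
  ext k
  cases k with
  | zero => simp [Fser, xfun]
  | succ k => simp [Fser, xfun, PowerSeries.coeff_one]

lemma Fser_rec (n : ℕ) : 4 * Fser (n + 1) = PowerSeries.X * (Fser n +
    2 * ∑ i ∈ Finset.range ((n + 1).factorization 2 + 1), Fser (n + 2 ^ i)) := by
  ext k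
  rw [coeff_four_mul_aux]
  cases k with
  | zero => simp [Fser, xfun]
  | succ k =>
    rw [PowerSeries.coeff_succ_X_mul, map_add, coeff_two_mul_aux, map_sum]
    simp only [Fser, PowerSeries.coeff_mk, xfun]
    push_cast
    rw [← Finset.sum_div]
    field_simp
    ring

lemma fact_two_pow_mul_odd (v c : ℕ) (hc : ¬ 2 ∣ c) : (2 ^ v * c).factorization 2 = v := by
  have hc0 : c ≠ 0 := by rintro rfl; simp at hc
  rw [Nat.factorization_mul (by positivity) hc0, Nat.Prime.factorization_pow Nat.prime_two]
  simp [Nat.factorization_eq_zero_of_not_dvd hc]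

lemma fact_facts (s m : ℕ) (hm : 0 < m) (hms : m < 2 ^ s) :
    (2 ^ s + m).factorization 2 = m.factorization 2 ∧
    ∀ i, i ≤ m.factorization 2 → m + 2 ^ i ≤ 2 ^ s := by
  obtain ⟨v, c, hc, rfl⟩ := Nat.exists_eq_two_pow_mul_odd hm.ne'
  have hc2 : ¬ 2 ∣ c := by
    intro h; have := hc; rw [Nat.odd_iff] at this; omega
  have hcp : 0 < c := by rcases Nat.eq_zero_or_pos c with h | h; · simp [h] at hc2
                         · exact h
  have hv : v < s := by
    have : 2 ^ v < 2 ^ s := lt_of_le_of_lt (Nat.le_mul_of_pos_right _ hcp) hms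
    exact (Nat.pow_lt_pow_iff_right (by norm_num)).1 this
  obtain ⟨d, rfl⟩ := Nat.exists_eq_add_of_lt hv
  rw [fact_two_pow_mul_odd v c hc2]
  have e : 2 ^ (v + d + 1) = 2 ^ v * 2 ^ (d + 1) := by ring
  constructor
  · rw [e, ← mul_add]
    apply fact_two_pow_mul_odd
    rw [pow_succ]; omega
  · intro i hi
    rw [e] at hms ⊢
    have h1 : c < 2 ^ (d + 1) := lt_of_mul_lt_mul_left hms (Nat.zero_le _)
    have h2 : 2 ^ i ≤ 2 ^ v := Nat.pow_le_pow_right (by norm_num) hi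
    calc 2 ^ v * c + 2 ^ i ≤ 2 ^ v * c + 2 ^ v := by omega
      _ = 2 ^ v * (c + 1) := by ring
      _ ≤ _ := Nat.mul_le_mul_left _ h1

lemma Fser_mul_aux (s k : ℕ) : ∀ m, m < 2 ^ s →
    PowerSeries.coeff k (Fser (2 ^ s + m)) = PowerSeries.coeff k (Fser m * Fser (2 ^ s)) := by
  induction k with
  | zero =>
    intro m hm
    rcases m with _ | m
    · simp [Fser_zero]
    · have h1 := congrArg (PowerSeries.coeff 0) (Fser_rec (2 ^ s + m))
      have h2 := congrArg (PowerSeries.coeff 0) (Fser_rec m)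
      rw [coeff_four_mul_aux, PowerSeries.coeff_zero_X_mul] at h1 h2
      have h3 : PowerSeries.coeff 0 (Fser (m + 1)) = 0 := by linarith
      simp only [PowerSeries.coeff_zero_eq_constantCoeff, map_mul] at h1 h3 ⊢
      rw [h3, ← add_assoc]; linarith
  | succ k ih =>
    intro m hm
    rcases m with _ | m
    · simp [Fser_zero]
    · obtain ⟨f1, f2⟩ := fact_facts s (m + 1) (by omega) hm
      have h1 := congrArg (PowerSeries.coeff (k + 1)) (Fser_rec (2 ^ s + m))
      have h2 := congrArg (fun p => PowerSeries.coeff (k + 1) (p * Fser (2 ^ s))) (Fser_rec m)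
      simp only [mul_assoc, add_mul, Finset.sum_mul] at h2
      rw [coeff_four_mul_aux, PowerSeries.coeff_succ_X_mul, map_add, coeff_two_mul_aux,
        map_sum] at h1 h2
      rw [ih m (by omega)] at h1
      have hf : (2 ^ s + m + 1).factorization 2 = (m + 1).factorization 2 := by
        rw [← f1, add_assoc]
      rw [hf] at h1
      have hs : ∑ i ∈ Finset.range ((m + 1).factorization 2 + 1),
          PowerSeries.coeff k (Fser (2 ^ s + m + 2 ^ i)) =
          ∑ i ∈ Finset.range ((m + 1).factorization 2 + 1),
          PowerSeries.coeff k (Fser (m + 2 ^ i) * Fser (2 ^ s)) := by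
        apply Finset.sum_congr rfl
        intro i hi
        have := f2 i (by simpa [Nat.lt_succ_iff] using hi)
        rw [add_assoc]
        exact ih _ (by omega)
      rw [hs] at h1
      rw [← add_assoc]
      linarith

lemma Fser_mul (s m : ℕ) (hm : m < 2 ^ s) : Fser (2 ^ s + m) = Fser m * Fser (2 ^ s) := by
  ext k; exact Fser_mul_aux s k m hm

lemma Fser_pow_rec (s : ℕ) : Fser (2 ^ s) *
    (4 - 2 * PowerSeries.X * ∑ i ∈ Finset.range (s + 1), Fser (2 ^ i - 1)) =
    PowerSeries.X * Fser (2 ^ s - 1) := by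
  have hp : 0 < 2 ^ s := by positivity
  have h := Fser_rec (2 ^ s - 1)
  have e : 2 ^ s - 1 + 1 = 2 ^ s := by omega
  rw [e, Nat.Prime.factorization_pow Nat.prime_two, Finsupp.single_eq_same] at h
  have hs : ∑ i ∈ Finset.range (s + 1), Fser (2 ^ s - 1 + 2 ^ i) =
      (∑ i ∈ Finset.range (s + 1), Fser (2 ^ i - 1)) * Fser (2 ^ s) := by
    rw [Finset.sum_mul]
    apply Finset.sum_congr rfl
    intro i hi
    have hi' : i ≤ s := by simpa [Nat.lt_succ_iff] using hi
    have h2 : 2 ^ i ≤ 2 ^ s := Nat.pow_le_pow_right (by norm_num) hi'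
    have h3 : 0 < 2 ^ i := by positivity
    rw [← Fser_mul s (2 ^ i - 1) (by omega)]
    congr 1; omega
  rw [hs] at h
  linear_combination h

lemma Fser_quad (s : ℕ) :
    Fser (2 ^ (s + 1)) * (1 - 2 * Fser (2 ^ s) ^ 2) = Fser (2 ^ s) ^ 2 := by
  have h0 := Fser_pow_rec s
  have h1 := Fser_pow_rec (s + 1)
  rw [Finset.sum_range_succ] at h1
  have hp : 0 < 2 ^ s := by positivity
  have e : Fser (2 ^ (s + 1) - 1) = Fser (2 ^ s - 1) * Fser (2 ^ s) := by
    rw [← Fser_mul s (2 ^ s - 1) (by omega)]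
    congr 1; rw [pow_succ]; omega
  rw [e] at h1
  set S := ∑ i ∈ Finset.range (s + 1), Fser (2 ^ i - 1)
  have hD : (4 - 2 * PowerSeries.X * S) ≠ 0 := by
    intro h
    have := congrArg PowerSeries.constantCoeff h
    rw [map_sub, map_mul, map_mul, PowerSeries.constantCoeff_X, map_ofNat, map_zero] at this
    norm_num at this
  apply mul_right_cancel₀ hD
  linear_combination h1 - (Fser (2 ^ s) + 2 * Fser (2 ^ (s+1)) * Fser (2 ^ s)) * h0

lemma Fser_one : Fser 1 * (4 - 2 * PowerSeries.X) = PowerSeries.X := by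
  have := Fser_pow_rec 0
  simpa [Fser_zero] using this

lemma Fser_nonneg (n k : ℕ) : 0 ≤ PowerSeries.coeff k (Fser n) := by
  simp only [Fser, PowerSeries.coeff_mk]; positivity

lemma hasSum_mul_coeff {p q : PowerSeries ℝ} {a b : ℝ}
    (hp0 : ∀ k, 0 ≤ PowerSeries.coeff k p) (hq0 : ∀ k, 0 ≤ PowerSeries.coeff k q)
    (hp : HasSum (fun k => PowerSeries.coeff k p) a)
    (hq : HasSum (fun k => PowerSeries.coeff k q) b) :
    HasSum (fun k => PowerSeries.coeff k (p * q)) (a * b) := by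
  have hp' : Summable fun k => ‖PowerSeries.coeff k p‖ := by
    simpa [Real.norm_eq_abs, abs_of_nonneg (hp0 _)] using hp.summable
  have hq' : Summable fun k => ‖PowerSeries.coeff k q‖ := by
    simpa [Real.norm_eq_abs, abs_of_nonneg (hq0 _)] using hq.summable
  have h1 := (summable_norm_sum_mul_antidiagonal_of_summable_norm hp' hq').of_norm
  have h2 := tsum_mul_tsum_eq_tsum_sum_antidiagonal_of_summable_norm hp' hq'
  rw [hp.tsum_eq, hq.tsum_eq] at h2
  simp only [PowerSeries.coeff_mul]
  rw [h2]
  exact h1.hasSum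

lemma sum_range_coeff_mul_le {p q : PowerSeries ℝ}
    (hp0 : ∀ k, 0 ≤ PowerSeries.coeff k p) (hq0 : ∀ k, 0 ≤ PowerSeries.coeff k q) (n : ℕ) :
    ∑ k ∈ Finset.range n, PowerSeries.coeff k (p * q) ≤
    (∑ k ∈ Finset.range n, PowerSeries.coeff k p) *
      ∑ k ∈ Finset.range n, PowerSeries.coeff k q := by
  simp only [PowerSeries.coeff_mul]
  rw [Finset.sum_mul_sum, ← Finset.sum_product', Finset.sum_sigma']
  have hinj : Set.InjOn (fun x : (_ : ℕ) × (ℕ × ℕ) => x.2)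
      (((Finset.range n).sigma fun k => Finset.HasAntidiagonal.antidiagonal k : Finset _) : Set _) := by
    rintro ⟨a, b⟩ ha ⟨c, d⟩ hc h
    simp only [Finset.coe_sigma, Set.mem_sigma_iff, Finset.mem_coe,
      Finset.HasAntidiagonal.mem_antidiagonal] at ha hc h
    obtain ⟨_, rfl⟩ := ha
    obtain ⟨_, rfl⟩ := hc
    subst h
    rfl
  rw [← Finset.sum_image (f := fun x : ℕ × ℕ => PowerSeries.coeff x.1 p * PowerSeries.coeff x.2 q)
    hinj]
  apply Finset.sum_le_sum_of_subset_of_nonneg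
  · intro x hx
    simp only [Finset.mem_image, Finset.mem_sigma, Finset.mem_range,
      Finset.HasAntidiagonal.mem_antidiagonal] at hx
    obtain ⟨⟨a, b⟩, ⟨h1, h2⟩, rfl⟩ := hx
    simp only [Finset.mem_product, Finset.mem_range]
    simp only at h1 h2
    omega
  · intro x _ _
    exact mul_nonneg (hp0 _) (hq0 _)

lemma hasSum_step {p q : PowerSeries ℝ} {g : ℝ}
    (hp0 : ∀ k, 0 ≤ PowerSeries.coeff k p) (hq0 : ∀ k, 0 ≤ PowerSeries.coeff k q)
    (hp : HasSum (fun k => PowerSeries.coeff k p) g) (hg : 2 * g ^ 2 < 1)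
    (h : q * (1 - 2 * p ^ 2) = p ^ 2) :
    HasSum (fun k => PowerSeries.coeff k q) (g ^ 2 / (1 - 2 * g ^ 2)) := by
  have hr := hasSum_mul_coeff hp0 hp0 hp hp
  have hr0 : ∀ k, 0 ≤ PowerSeries.coeff k (p * p) := by
    intro k
    rw [PowerSeries.coeff_mul]
    exact Finset.sum_nonneg fun x _ => mul_nonneg (hp0 _) (hp0 _)
  have he : q = p * p + 2 * ((p * p) * q) := by linear_combination h
  have hc : ∀ k, PowerSeries.coeff k q =
      PowerSeries.coeff k (p * p) + 2 * PowerSeries.coeff k ((p * p) * q) := by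
    intro k
    conv_lhs => rw [he]
    rw [map_add, coeff_two_mul_aux]
  have hsum : Summable fun k => PowerSeries.coeff k q := by
    apply summable_of_sum_range_le (c := g ^ 2 / (1 - 2 * g ^ 2)) hq0
    intro n
    rw [le_div_iff₀ (by linarith)]
    have h1 : ∑ k ∈ Finset.range n, PowerSeries.coeff k (p * p) ≤ g * g :=
      sum_le_hasSum _ (fun i _ => hr0 i) hr
    have h2 := sum_range_coeff_mul_le hr0 hq0 n
    have h3 : 0 ≤ ∑ k ∈ Finset.range n, PowerSeries.coeff k q :=
      Finset.sum_nonneg fun x _ => hq0 _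
    have h4 : ∑ k ∈ Finset.range n, PowerSeries.coeff k q =
        ∑ k ∈ Finset.range n, PowerSeries.coeff k (p * p) +
        2 * ∑ k ∈ Finset.range n, PowerSeries.coeff k ((p * p) * q) := by
      rw [Finset.mul_sum, ← Finset.sum_add_distrib]
      exact Finset.sum_congr rfl fun k _ => hc k
    nlinarith [mul_le_mul_of_nonneg_right h1 h3]
  obtain ⟨b, hb⟩ := hsum
  have h5 := hr.add ((hasSum_mul_coeff hr0 hq0 hr hb).mul_left 2)
  have h6 : HasSum (fun k => PowerSeries.coeff k q) (g * g + 2 * (g * g * b)) := by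
    convert h5 using 2 with k
    exact hc k
  have h7 := hb.unique h6
  have : b = g ^ 2 / (1 - 2 * g ^ 2) := by
    rw [eq_div_iff (by linarith)]; linarith
  rwa [← this]

lemma rescale_nonneg {w : ℝ} (hw : 0 ≤ w) (n k : ℕ) :
    0 ≤ PowerSeries.coeff k (PowerSeries.rescale w (Fser n)) := by
  rw [PowerSeries.coeff_rescale]
  exact mul_nonneg (pow_nonneg hw _) (Fser_nonneg _ _)

lemma coeff_Fser_one (k : ℕ) : PowerSeries.coeff (k + 1) (Fser 1) = (1 / 4) * (1 / 2) ^ k := by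
  have h : 4 * Fser 1 = PowerSeries.X * (1 + 2 * Fser 1) := by linear_combination Fser_one
  have h0 : PowerSeries.coeff 0 (Fser 1) = 0 := by
    have := congrArg (PowerSeries.coeff 0) h
    rw [coeff_four_mul_aux, PowerSeries.coeff_zero_X_mul] at this
    linarith
  have hs : ∀ k, 4 * PowerSeries.coeff (k + 1) (Fser 1) =
      PowerSeries.coeff k 1 + 2 * PowerSeries.coeff k (Fser 1) := by
    intro k
    have := congrArg (PowerSeries.coeff (k + 1)) h
    rwa [coeff_four_mul_aux, PowerSeries.coeff_succ_X_mul, map_add, coeff_two_mul_aux] at this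
  induction k with
  | zero => have := hs 0; rw [h0, PowerSeries.coeff_zero_one] at this; norm_num; linarith
  | succ k ih =>
    have := hs (k + 1)
    rw [PowerSeries.coeff_one, if_neg (by omega), ih] at this
    rw [pow_succ]; linarith

lemma hasSum_base {w : ℝ} (hw0 : 0 ≤ w) (hw : w < 2) :
    HasSum (fun k => PowerSeries.coeff k (PowerSeries.rescale w (Fser 1))) (w / (4 - 2 * w)) := by
  have h0 : PowerSeries.coeff 0 (Fser 1) = 0 := by simp [Fser, xfun]
  rw [← hasSum_nat_add_iff' 1]
  simp only [Finset.sum_range_one, PowerSeries.coeff_rescale, h0, coeff_Fser_one]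
  have h := (hasSum_geometric_of_lt_one (r := w / 2) (by positivity) (by linarith)).mul_left (w / 4)
  have e1 : (fun k : ℕ => w ^ (k + 1) * (1 / 4 * (1 / 2 : ℝ) ^ k)) =
      fun k => w / 4 * (w / 2) ^ k := by
    funext k; rw [div_pow, div_pow, pow_succ]; field_simp; simp
  have e2 : w / (4 - 2 * w) - w ^ 0 * 0 = w / 4 * (1 - w / 2)⁻¹ := by
    have h1 : (4 - 2 * w) ≠ 0 := by linarith
    have h2 : 1 - w / 2 ≠ 0 := by linarith
    rw [mul_zero, sub_zero, div_eq_iff h1]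
    have h3 : 4 - 2 * w = 4 * (1 - w / 2) := by ring
    rw [h3, show w / 4 * (1 - w / 2)⁻¹ * (4 * (1 - w / 2)) = w * ((1 - w / 2)⁻¹ * (1 - w / 2)) by ring,
      inv_mul_cancel₀ h2, mul_one]
  rw [e1, e2]
  exact h

lemma hasSum_cos (φ : ℝ) (hφ : 0 ≤ φ) (s : ℕ) (hs : 2 ^ s * φ < Real.pi / 2) :
    HasSum (fun k => PowerSeries.coeff k (PowerSeries.rescale (2 / (1 + Real.cos φ))
      (Fser (2 ^ s)))) (1 / (2 * Real.cos (2 ^ s * φ))) := by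
  induction s with
  | zero =>
    have hc : 0 < Real.cos φ := Real.cos_pos_of_mem_Ioo ⟨by linarith [Real.pi_pos], by simpa using hs⟩
    have h := hasSum_base (w := 2 / (1 + Real.cos φ)) (by positivity)
      (by rw [div_lt_iff₀ (by positivity)]; linarith)
    rw [pow_zero, pow_zero, one_mul]
    convert h using 1
    have : (4 - 2 * (2 / (1 + Real.cos φ))) = 4 * Real.cos φ / (1 + Real.cos φ) := by
      field_simp; ring
    rw [this]
    field_simp; norm_num
  | succ s ih =>
    have hpos : 0 ≤ 2 ^ s * φ := by positivity
    have e : (2 : ℝ) ^ (s + 1) * φ = 2 * (2 ^ s * φ) := by ring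
    rw [e] at hs
    have hlt : 2 ^ s * φ < Real.pi / 2 := by linarith
    have hc : 0 < Real.cos (2 ^ s * φ) :=
      Real.cos_pos_of_mem_Ioo ⟨by linarith [Real.pi_pos], hlt⟩
    have hc2 : 0 < Real.cos (2 * (2 ^ s * φ)) :=
      Real.cos_pos_of_mem_Ioo ⟨by linarith [Real.pi_pos], hs⟩
    have hφ2 : φ < Real.pi / 2 := by
      have : 1 * φ ≤ 2 ^ s * φ := mul_le_mul_of_nonneg_right (one_le_pow₀ (by norm_num)) hφ
      linarith
    have hc0 : 0 < Real.cos φ := Real.cos_pos_of_mem_Ioo ⟨by linarith [Real.pi_pos], hφ2⟩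
    have hw : 0 ≤ 2 / (1 + Real.cos φ) := by positivity
    rw [Real.cos_two_mul] at hc2
    rw [e, Real.cos_two_mul]
    have hq := congrArg (PowerSeries.rescale (2 / (1 + Real.cos φ))) (Fser_quad s)
    rw [map_mul, map_sub, map_mul, map_pow, map_one, map_ofNat] at hq
    have h := hasSum_step (rescale_nonneg hw _) (rescale_nonneg hw _) (ih hlt) (by
      rw [div_pow, mul_div_assoc', div_lt_one (by positivity)]; nlinarith) hq
    convert h using 1
    set c := Real.cos (2 ^ s * φ)
    have h3 : 1 - 2 * (1 / (2 * c)) ^ 2 = (2 * c ^ 2 - 1) / (2 * c ^ 2) := by field_simp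
    rw [h3]
    have : 2 * c ^ 2 - 1 ≠ 0 := hc2.ne'
    field_simp
    try norm_num

/-- Ballot numbers, normalised: `[w^k] u^M` where `4u = w(1+u)^2`. -/
noncomputable def ballot (M k : ℕ) : ℝ := (M : ℝ) / k * ((2 * k).choose (k + M) : ℝ) / 4 ^ k

lemma choose_ratio (k M : ℕ) : ((k : ℝ) + M + 1) * ((2 * k).choose (k + M + 1) : ℝ) =
    ((k : ℝ) - M) * ((2 * k).choose (k + M) : ℝ) := by
  have h := Nat.choose_succ_right_eq (2 * k) (k + M)
  rcases le_or_gt M k with hM | hM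
  · obtain ⟨d, rfl⟩ := Nat.exists_eq_add_of_le hM
    have e : 2 * (M + d) - (M + d + M) = d := by omega
    rw [e] at h
    have h' : ((2 * (M + d)).choose (M + d + M + 1) : ℝ) * (M + d + M + 1) =
      ((2 * (M + d)).choose (M + d + M) : ℝ) * d := by exact_mod_cast h
    push_cast
    linarith
  · rw [Nat.choose_eq_zero_of_lt (by omega : 2 * k < k + M),
      Nat.choose_eq_zero_of_lt (by omega : 2 * k < k + M + 1)]
    simp

lemma ballot_rec (M k : ℕ) (hk : 1 ≤ k) :
    4 * ballot (M + 1) (k + 1) = ballot M k + 2 * ballot (M + 1) k + ballot (M + 2) k := by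
  have h1 := choose_ratio k M
  have h2 := choose_ratio k (M + 1)
  have h3 : ((2 * (k + 1)).choose (k + 1 + (M + 1)) : ℝ) = (2 * k).choose (k + M) +
      2 * (2 * k).choose (k + M + 1) + (2 * k).choose (k + M + 2) := by
    have e : 2 * (k + 1) = 2 * k + 1 + 1 := by ring
    have e2 : k + 1 + (M + 1) = k + M + 1 + 1 := by ring
    rw [e, e2, Nat.choose_succ_succ, Nat.choose_succ_succ, Nat.choose_succ_succ]
    push_cast; ring
  have hk' : (0 : ℝ) < k := by exact_mod_cast hk
  unfold ballot
  rw [h3]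
  have e1 : k + (M + 1) = k + M + 1 := by ring
  have e2 : k + (M + 2) = k + M + 2 := by ring
  have e3 : k + (M + 1) + 1 = k + M + 2 := by ring
  rw [e3, e1] at h2
  rw [e1, e2]
  push_cast at h2 ⊢
  set a : ℝ := ((2 * k).choose (k + M) : ℝ)
  set b : ℝ := ((2 * k).choose (k + M + 1) : ℝ)
  set c : ℝ := ((2 * k).choose (k + M + 2) : ℝ)
  rw [pow_succ]
  field_simp
  linear_combination (-1 : ℝ) * h1 - h2

lemma ballot_succ_le (M K : ℕ) : ballot M K = (M : ℝ) / K * ((2 * K).choose (K + M) / 4 ^ K) := by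
  unfold ballot; ring

/-- The series `u`. -/
noncomputable def Useries : PowerSeries ℝ :=
  PowerSeries.rescale (1 / 4 : ℝ) (PowerSeries.map (Nat.castRingHom ℝ) PowerSeries.catalanSeries) - 1

lemma Useries_eq : 4 * Useries = PowerSeries.X * (1 + Useries) ^ 2 := by
  have h := congrArg (fun p => PowerSeries.rescale (1 / 4 : ℝ)
    (PowerSeries.map (Nat.castRingHom ℝ) p)) PowerSeries.catalanSeries_sq_mul_X_add_one
  simp only [map_add, map_mul, map_pow, map_one, PowerSeries.map_X, PowerSeries.rescale_X] at h
  have h4 : (4 : PowerSeries ℝ) * PowerSeries.C (1 / 4 : ℝ) = 1 := by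
    have : (4 : PowerSeries ℝ) = PowerSeries.C 4 := (map_ofNat PowerSeries.C 4).symm
    rw [this, ← map_mul]; norm_num
  unfold Useries
  set c := PowerSeries.rescale (1 / 4 : ℝ)
    (PowerSeries.map (Nat.castRingHom ℝ) PowerSeries.catalanSeries)
  linear_combination (-4 : PowerSeries ℝ) * h + c ^ 2 * PowerSeries.X * h4

lemma Useries_dvd : PowerSeries.X ∣ Useries := by
  rw [PowerSeries.X_dvd_iff]
  have := congrArg PowerSeries.constantCoeff Useries_eq
  rw [map_mul, map_mul, PowerSeries.constantCoeff_X, map_ofNat] at this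
  linarith

lemma coeff_Useries_pow (k : ℕ) : ∀ M : ℕ, PowerSeries.coeff k (Useries ^ (M + 1)) =
    ballot (M + 1) k := by
  have hrec : ∀ k M, 4 * PowerSeries.coeff (k + 1) (Useries ^ (M + 1)) =
      PowerSeries.coeff k (Useries ^ M) + 2 * PowerSeries.coeff k (Useries ^ (M + 1)) +
      PowerSeries.coeff k (Useries ^ (M + 2)) := by
    intro k M
    have : 4 * Useries ^ (M + 1) = PowerSeries.X *
        (Useries ^ M + 2 * Useries ^ (M + 1) + Useries ^ (M + 2)) := by
      linear_combination Useries ^ M * Useries_eq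
    have := congrArg (PowerSeries.coeff (k + 1)) this
    rwa [coeff_four_mul_aux, PowerSeries.coeff_succ_X_mul, map_add, map_add,
      coeff_two_mul_aux] at this
  have h0 : ∀ M, PowerSeries.coeff 0 (Useries ^ (M + 1)) = 0 := by
    intro M
    have h := Useries_dvd
    rw [PowerSeries.X_dvd_iff] at h
    simp [h]
  induction k with
  | zero =>
    intro M
    rw [h0]; simp [ballot]
  | succ k ih =>
    intro M
    have h := hrec k M
    rcases Nat.eq_zero_or_pos k with rfl | hk
    · rw [h0, h0] at h
      rcases M with _ | M
      · simp at h
        simp [ballot, Nat.choose]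
        linarith
      · rw [h0] at h
        have : 2 < 1 + (M + 1 + 1) := by omega
        simp [ballot, Nat.choose_eq_zero_of_lt this]
        simpa using h
    · have hb := ballot_rec M k hk
      rw [ih M, ih (M + 1)] at h
      have : PowerSeries.coeff k (Useries ^ M) = ballot M k := by
        rcases M with _ | M
        · simp [ballot, PowerSeries.coeff_one, hk.ne']
        · exact ih M
      rw [this] at h
      linarith

lemma Fser_Useries (s : ℕ) : Fser (2 ^ s) * (1 + (Useries ^ 2 ^ s) ^ 2) = Useries ^ 2 ^ s := by
  induction s with
  | zero =>
    have hD : (4 - 2 * PowerSeries.X : PowerSeries ℝ) ≠ 0 := by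
      intro h
      have := congrArg PowerSeries.constantCoeff h
      rw [map_sub, map_mul, PowerSeries.constantCoeff_X, map_ofNat, map_zero] at this
      norm_num at this
    apply mul_right_cancel₀ hD
    have h := Useries_eq
    have h1 := Fser_one
    rw [pow_zero, pow_one]
    linear_combination (1 + Useries ^ 2) * h1 - h
  | succ s ih =>
    have hq := Fser_quad s
    have e : Useries ^ 2 ^ (s + 1) = (Useries ^ 2 ^ s) ^ 2 := by
      rw [← pow_mul, pow_succ]
    rw [e]
    set V := Useries ^ 2 ^ s
    set g := Fser (2 ^ s)
    set G := Fser (2 ^ (s + 1))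
    linear_combination (1 + V ^ 2) ^ 2 * hq + (1 + 2 * G) * (g * (1 + V ^ 2) + V) * ih

lemma coeff_Fser_pow (s k n : ℕ) (hn : k ≤ n) : PowerSeries.coeff k (Fser (2 ^ s)) =
    ∑ m ∈ Finset.range (n + 1), (-1) ^ m * ballot ((2 * m + 1) * 2 ^ s) k := by
  have hU := Fser_Useries s
  set V := Useries ^ 2 ^ s with hV
  set g := Fser (2 ^ s)
  have hgeom := geom_sum_mul (-V ^ 2) (n + 1)
  have hg : g = V * (∑ i ∈ Finset.range (n + 1), (-V ^ 2) ^ i) + g * (-V ^ 2) ^ (n + 1) := by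
    linear_combination g * hgeom + (∑ i ∈ Finset.range (n + 1), (-V ^ 2) ^ i) * hU
  have hXV : PowerSeries.X ∣ V := by
    rw [hV]
    exact Useries_dvd.trans (dvd_pow_self _ (by positivity))
  have hz : PowerSeries.coeff k (g * (-V ^ 2) ^ (n + 1)) = 0 := by
    have h1 : (PowerSeries.X : PowerSeries ℝ) ^ (n + 1) ∣ g * (-V ^ 2) ^ (n + 1) := by
      apply Dvd.dvd.mul_left
      apply pow_dvd_pow_of_dvd
      rw [dvd_neg]
      exact hXV.trans (dvd_pow_self _ (by norm_num))
    rw [PowerSeries.X_pow_dvd_iff] at h1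
    exact h1 k (by omega)
  conv_lhs => rw [hg]
  rw [map_add, hz, add_zero, Finset.mul_sum, map_sum]
  apply Finset.sum_congr rfl
  intro m _
  have e : V * (-V ^ 2) ^ m = PowerSeries.C ((-1 : ℝ) ^ m) * Useries ^ ((2 * m + 1) * 2 ^ s) := by
    rw [map_pow, map_neg, map_one, neg_pow, hV, ← pow_mul, ← pow_mul]
    rw [mul_left_comm, ← pow_add]
    congr 2; ring
  rw [e, PowerSeries.coeff_C_mul]
  have hpos : 0 < (2 * m + 1) * 2 ^ s := by positivity
  obtain ⟨d, hd⟩ := Nat.exists_eq_add_of_lt hpos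
  rw [zero_add] at hd
  rw [hd, coeff_Useries_pow]

lemma ballot_diff (M k : ℕ) (hk : 1 ≤ k) : (k : ℝ) * (2 * k + 1) *
    (ballot (M + 1) (k + 1) - ballot (M + 1) k) =
    ballot (M + 1) (k + 1) * (2 * ((M : ℝ) + 1) ^ 2 - 3 * k - 2) := by
  have h1 := choose_ratio k M
  have h2 := choose_ratio k (M + 1)
  have h3 : ((2 * (k + 1)).choose (k + 1 + (M + 1)) : ℝ) = (2 * k).choose (k + M) +
      2 * (2 * k).choose (k + M + 1) + (2 * k).choose (k + M + 2) := by
    have e : 2 * (k + 1) = 2 * k + 1 + 1 := by ring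
    have e2 : k + 1 + (M + 1) = k + M + 1 + 1 := by ring
    rw [e, e2, Nat.choose_succ_succ, Nat.choose_succ_succ, Nat.choose_succ_succ]
    push_cast; ring
  have hk' : (0 : ℝ) < k := by exact_mod_cast hk
  unfold ballot
  have e1 : k + (M + 1) = k + M + 1 := by ring
  have e3 : k + (M + 1) + 1 = k + M + 2 := by ring
  rw [e3, e1] at h2
  have h4 : ((k : ℝ) - M) * (k + 2 + M) * ((2 * (k + 1)).choose (k + 1 + (M + 1)) : ℝ) =
      (2 * k + 2) * (2 * k + 1) * ((2 * k).choose (k + M + 1) : ℝ) := by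
    rw [h3]
    push_cast at h2
    linear_combination (-(k + 2 + M : ℝ)) * h1 + (k - M : ℝ) * h2
  rw [e1]
  push_cast
  set a : ℝ := ((2 * (k + 1)).choose (k + 1 + (M + 1)) : ℝ)
  set b : ℝ := ((2 * k).choose (k + M + 1) : ℝ)
  rw [pow_succ]
  field_simp
  linear_combination 2 * h4

lemma central_bound (K : ℕ) :
    (((2 * K).choose K : ℝ) / 4 ^ K) ^ 2 * (2 * K + 1) ≤ 1 := by
  induction K with
  | zero => simp
  | succ K ih =>
    have h := Nat.succ_mul_centralBinom_succ K
    rw [Nat.centralBinom, Nat.centralBinom] at h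
    have h' : ((K : ℝ) + 1) * ((2 * (K + 1)).choose (K + 1) : ℝ) =
      2 * (2 * K + 1) * ((2 * K).choose K : ℝ) := by exact_mod_cast h
    set a : ℝ := ((2 * (K + 1)).choose (K + 1) : ℝ)
    set b : ℝ := ((2 * K).choose K : ℝ)
    have e : a / 4 ^ (K + 1) = (b / 4 ^ K) * ((2 * K + 1) / (2 * K + 2)) := by
      have : a = 2 * (2 * K + 1) * b / (K + 1) := by
        rw [eq_div_iff (by positivity)]; linarith
      rw [this, pow_succ]; field_simp; ring
    rw [e, mul_pow]
    have h2 : ((2 * (K : ℝ) + 1) / (2 * K + 2)) ^ 2 * (2 * (K + 1 : ℕ) + 1) ≤ 2 * K + 1 := by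
      rw [div_pow, div_mul_eq_mul_div, div_le_iff₀ (by positivity)]
      push_cast
      have : (0 : ℝ) ≤ K := by positivity
      nlinarith
    calc _ = (b / 4 ^ K) ^ 2 * (((2 * (K : ℝ) + 1) / (2 * K + 2)) ^ 2 * (2 * (K + 1 : ℕ) + 1)) := by
          ring
      _ ≤ (b / 4 ^ K) ^ 2 * (2 * K + 1) := by gcongr
      _ ≤ 1 := ih

lemma choose_gauss (K M : ℕ) (hK : 1 ≤ K) : ((2 * K).choose (K + M) : ℝ) ≤
    (2 * K).choose K * Real.exp (-((M : ℝ) ^ 2 / (2 * K))) := by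
  have hK' : (0 : ℝ) < K := by exact_mod_cast hK
  induction M with
  | zero => simp
  | succ M ih =>
    rcases lt_or_ge M K with hM | hM
    · have h := choose_ratio K M
      have hM' : (M : ℝ) + 1 ≤ K := by exact_mod_cast hM
      have h1 : ((2 * K).choose (K + (M + 1)) : ℝ) =
          ((2 * K).choose (K + M) : ℝ) * (1 - (2 * M + 1) / (K + M + 1)) := by
        rw [← add_assoc]
        have hp : (K : ℝ) + M + 1 ≠ 0 := by positivity
        apply mul_left_cancel₀ hp
        rw [h]; field_simp; ring
      have h2 : 1 - (2 * (M : ℝ) + 1) / (K + M + 1) ≤ Real.exp (-((2 * M + 1) / (2 * K))) := by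
        have h3 : (2 * (M : ℝ) + 1) / (2 * K) ≤ (2 * (M : ℝ) + 1) / (K + M + 1) := by
          apply div_le_div_of_nonneg_left <;> first | positivity | linarith
        have := Real.add_one_le_exp (-((2 * (M : ℝ) + 1) / (2 * K)))
        linarith
      rw [h1]
      have h0 : (0 : ℝ) ≤ ((2 * K).choose (K + M) : ℝ) := by positivity
      calc _ ≤ ((2 * K).choose (K + M) : ℝ) * Real.exp (-((2 * M + 1) / (2 * K))) := by gcongr
        _ ≤ (2 * K).choose K * Real.exp (-((M : ℝ) ^ 2 / (2 * K))) *
            Real.exp (-((2 * M + 1) / (2 * K))) := by gcongr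
        _ = _ := by
          rw [mul_assoc, ← Real.exp_add]
          congr 2
          push_cast
          field_simp
          ring
    · rw [Nat.choose_eq_zero_of_lt (by omega)]
      simp; positivity

lemma ballot_nonneg (M k : ℕ) : 0 ≤ ballot M k := by unfold ballot; positivity

lemma ballot_sq (M K : ℕ) (hK : 1 ≤ K) :
    ballot M K ^ 2 ≤ (M : ℝ) ^ 2 / K ^ 3 * Real.exp (-((M : ℝ) ^ 2 / K)) := by
  have hK' : (0 : ℝ) < K := by exact_mod_cast hK
  have h1 := choose_gauss K M hK
  have h2 := central_bound K
  set b : ℝ := ((2 * K).choose K : ℝ)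
  set E := Real.exp (-((M : ℝ) ^ 2 / (2 * K))) with hE
  have hE2 : E ^ 2 = Real.exp (-((M : ℝ) ^ 2 / K)) := by
    rw [hE, ← Real.exp_nat_mul]; congr 1; field_simp; push_cast; ring
  have h3 : ballot M K ≤ (M : ℝ) / K * (b * E) / 4 ^ K := by
    unfold ballot; gcongr
  have h4 : (b / 4 ^ K) ^ 2 ≤ 1 / K := by
    rw [le_div_iff₀ hK']
    have : 0 ≤ (b / 4 ^ K) ^ 2 := by positivity
    nlinarith
  calc ballot M K ^ 2 ≤ ((M : ℝ) / K * (b * E) / 4 ^ K) ^ 2 := by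
        have := ballot_nonneg M K
        gcongr
    _ = ((M : ℝ) / K) ^ 2 * E ^ 2 * (b / 4 ^ K) ^ 2 := by ring
    _ ≤ ((M : ℝ) / K) ^ 2 * E ^ 2 * (1 / K) := by gcongr
    _ = _ := by rw [hE2]; field_simp

lemma pow_exp_neg (n : ℕ) (t : ℝ) (ht : 0 ≤ t) : t ^ n * Real.exp (-t) ≤ n.factorial := by
  have h := Real.pow_div_factorial_le_exp t ht n
  rw [div_le_iff₀ (by positivity)] at h
  rw [Real.exp_neg, ← div_eq_mul_inv, div_le_iff₀ (Real.exp_pos _)]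
  linarith

lemma ballot_lip (M k : ℕ) (hM : 1 ≤ M) :
    |ballot M (k + 1) - ballot M k| ≤ 400 / (M : ℝ) ^ 4 := by
  have hM' : (1 : ℝ) ≤ M := by exact_mod_cast hM
  obtain ⟨m, rfl⟩ : ∃ m, M = m + 1 := ⟨M - 1, by omega⟩
  rcases Nat.eq_zero_or_pos k with rfl | hk
  · rcases m with _ | m
    · simp [ballot, Nat.choose]; norm_num [abs_le]
    · have : 2 < 1 + (m + 1 + 1) := by omega
      simp [ballot, Nat.choose_eq_zero_of_lt this]
      positivity
  · have hd := ballot_diff m k hk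
    have hs := ballot_sq (m + 1) (k + 1) (by omega)
    have hb := ballot_nonneg (m + 1) (k + 1)
    have hk' : (1 : ℝ) ≤ k := by exact_mod_cast hk
    push_cast at hs hM' ⊢
    set D := ballot (m + 1) (k + 1) - ballot (m + 1) k
    set B := ballot (m + 1) (k + 1)
    set x : ℝ := (m : ℝ) + 1
    set K : ℝ := (k : ℝ) + 1 with hKdef
    have hK : 0 < K := by linarith
    set t := x ^ 2 / K with ht
    have ht0 : 0 ≤ t := by positivity
    have hx : 0 < x := by linarith
    have h1 : |D| ≤ B * (t * (4 * t + 5) / x ^ 2) := by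
      have e : t * (4 * t + 5) / x ^ 2 = (4 * x ^ 2 + 5 * K) / K ^ 2 := by
        rw [ht]; field_simp
      rw [e]
      have hD : D = B * ((2 * x ^ 2 - 3 * k - 2) / (k * (2 * k + 1))) := by
        rw [mul_div_assoc', eq_div_iff (by positivity)]; linarith
      rw [hD, abs_mul, abs_of_nonneg hb]
      apply mul_le_mul_of_nonneg_left _ hb
      rw [abs_div, abs_of_pos (by positivity : (0 : ℝ) < k * (2 * k + 1)),
        div_le_div_iff₀ (by positivity) (by positivity)]
      have h5 : |2 * x ^ 2 - 3 * k - 2| ≤ 3 * x ^ 2 + 15 * k / 4 + 15 / 4 := by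
        rw [abs_le]; constructor <;> nlinarith
      have h6 : K ^ 2 ≤ 4 / 3 * (k * (2 * k + 1)) := by rw [hKdef]; nlinarith
      have h7 : 3 * x ^ 2 + 15 * (k : ℝ) / 4 + 15 / 4 = (4 * x ^ 2 + 5 * K) * (3 / 4) := by
        rw [hKdef]; ring
      rw [h7] at h5
      calc _ ≤ (4 * x ^ 2 + 5 * K) * (3 / 4) * (4 / 3 * (k * (2 * k + 1))) := by
            apply mul_le_mul h5 h6 <;> positivity
        _ = _ := by ring
    have h2 : D ^ 2 ≤ (400 / x ^ 4) ^ 2 := by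
      have e1 : B ^ 2 ≤ t ^ 3 * Real.exp (-t) / x ^ 4 := by
        refine hs.trans (le_of_eq ?_)
        have e2 : t ^ 3 = x ^ 6 / K ^ 3 := by rw [ht, div_pow]; ring
        rw [e2]; field_simp
      calc D ^ 2 = |D| ^ 2 := (sq_abs D).symm
        _ ≤ (B * (t * (4 * t + 5) / x ^ 2)) ^ 2 := by gcongr
        _ = B ^ 2 * (t * (4 * t + 5) / x ^ 2) ^ 2 := by ring
        _ ≤ t ^ 3 * Real.exp (-t) / x ^ 4 * (t * (4 * t + 5) / x ^ 2) ^ 2 := by gcongr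
        _ = (16 * (t ^ 7 * Real.exp (-t)) + 40 * (t ^ 6 * Real.exp (-t)) +
              25 * (t ^ 5 * Real.exp (-t))) / x ^ 8 := by field_simp; ring
        _ ≤ (16 * (Nat.factorial 7 : ℝ) + 40 * (Nat.factorial 6 : ℝ) +
              25 * (Nat.factorial 5 : ℝ)) / x ^ 8 := by
            gcongr <;> exact pow_exp_neg _ _ ht0
        _ ≤ 160000 / x ^ 8 := by
            gcongr
            norm_num [Nat.factorial]
        _ = _ := by rw [div_pow]; ring
    exact abs_le_of_sq_le_sq h2 (by positivity)

lemma exists_lip : ∃ C : ℝ, 0 < C ∧ ∀ s k : ℕ,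
    |PowerSeries.coeff (k + 1) (Fser (2 ^ s)) - PowerSeries.coeff k (Fser (2 ^ s))| ≤
      C / ((2 : ℝ) ^ s) ^ 4 := by
  have hsum : Summable fun m : ℕ => 1 / ((m : ℝ) + 1) ^ 2 := by
    have := (summable_nat_add_iff 1).2 (Real.summable_one_div_nat_pow.2 (by norm_num : 1 < 2))
    simpa using this
  refine ⟨400 * (∑' m : ℕ, 1 / ((m : ℝ) + 1) ^ 2) + 1, ?_, ?_⟩
  · have : 0 ≤ ∑' m : ℕ, 1 / ((m : ℝ) + 1) ^ 2 := tsum_nonneg fun m => by positivity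
    positivity
  intro s k
  rw [coeff_Fser_pow s (k + 1) (k + 1) le_rfl, coeff_Fser_pow s k (k + 1) (by omega),
    ← Finset.sum_sub_distrib]
  have h1 : ∀ m ∈ Finset.range (k + 1 + 1),
      |(-1) ^ m * ballot ((2 * m + 1) * 2 ^ s) (k + 1) - (-1) ^ m * ballot ((2 * m + 1) * 2 ^ s) k|
      ≤ 400 / ((2 : ℝ) ^ s) ^ 4 * (1 / ((m : ℝ) + 1) ^ 2) := by
    intro m _
    rw [← mul_sub, abs_mul, abs_pow, abs_neg, abs_one, one_pow, one_mul]
    refine (ballot_lip _ k (Nat.pos_of_ne_zero (by positivity))).trans ?_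
    push_cast
    rw [div_mul_div_comm, mul_one, mul_pow, mul_comm]
    apply div_le_div_of_nonneg_left (by norm_num) (by positivity)
    gcongr
    have : (0 : ℝ) ≤ m := by positivity
    calc ((m : ℝ) + 1) ^ 2 ≤ (2 * (m : ℝ) + 1) ^ 2 := by gcongr; linarith
      _ ≤ (2 * (m : ℝ) + 1) ^ 4 := pow_le_pow_right₀ (by linarith) (by norm_num)
  refine (Finset.abs_sum_le_sum_abs _ _).trans ((Finset.sum_le_sum h1).trans ?_)
  rw [← Finset.mul_sum]
  have h2 := hsum.sum_le_tsum (Finset.range (k + 1 + 1)) (fun i _ => by positivity)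
  calc _ ≤ 400 / ((2 : ℝ) ^ s) ^ 4 * ∑' m : ℕ, 1 / ((m : ℝ) + 1) ^ 2 := by gcongr
    _ = (400 * ∑' m : ℕ, 1 / ((m : ℝ) + 1) ^ 2) / ((2 : ℝ) ^ s) ^ 4 := by ring
    _ ≤ _ := by gcongr; linarith

lemma window_bound {a : ℕ → ℝ} {L S : ℝ} (hL : 0 < L) (ha : ∀ k, 0 ≤ a k)
    (hlip : ∀ k, |a (k + 1) - a k| ≤ L) (k : ℕ)
    (hS : ∀ n, ∑ j ∈ Finset.range n, a (k + j) ≤ S) : a k ^ 2 ≤ 2 * L * S := by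
  have h1 : ∀ j : ℕ, a k - j * L ≤ a (k + j) := by
    intro j
    induction j with
    | zero => simp
    | succ j ih =>
      have := (abs_le.1 (hlip (k + j))).1
      rw [← add_assoc]; push_cast; linarith
  have hsum : ∀ n : ℕ, ∑ j ∈ Finset.range n, (a k - j * L) = n * a k - L * (n * (n - 1) / 2) := by
    intro n
    induction n with
    | zero => simp
    | succ n ih => rw [Finset.sum_range_succ, ih]; push_cast; ring
  set n := ⌊a k / L⌋₊ + 1 with hn
  have hn1 : a k / L < n := by rw [hn]; push_cast; exact Nat.lt_floor_add_one _
  have hn2 : (n : ℝ) - 1 ≤ a k / L := by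
    rw [hn]; push_cast; simp; exact Nat.floor_le (div_nonneg (ha k) hL.le)
  rw [div_lt_iff₀ hL] at hn1
  rw [le_div_iff₀ hL] at hn2
  have h2 : (n : ℝ) * a k - L * (n * (n - 1) / 2) ≤ S := by
    rw [← hsum]
    exact (Finset.sum_le_sum fun j _ => h1 j).trans (hS n)
  have hn0 : (0 : ℝ) ≤ n := by positivity
  have h3 : (n : ℝ) * a k / 2 ≤ S := by nlinarith [mul_le_mul_of_nonneg_left hn2 hn0]
  nlinarith [mul_le_mul_of_nonneg_left hn1.le (ha k), ha k]

lemma tail_bound (s k n : ℕ) : ∑ j ∈ Finset.range n, PowerSeries.coeff (k + j) (Fser (2 ^ s)) ≤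
    Real.exp (-((k : ℝ) / (16 * 4 ^ s))) := by
  set N : ℝ := 2 ^ s with hN
  have hN1 : 1 ≤ N := one_le_pow₀ (by norm_num)
  set φ := Real.pi / (4 * N) with hφ
  have hφ0 : 0 < φ := by positivity
  have hNφ : N * φ = Real.pi / 4 := by rw [hφ]; field_simp
  have h := hasSum_cos φ hφ0.le s (by rw [← hN, hNφ]; linarith [Real.pi_pos])
  rw [← hN, hNφ, Real.cos_pi_div_four] at h
  have hφ4 : φ ≤ Real.pi / 4 := by rw [← hNφ]; nlinarith
  have hle1 : 1 / (2 * (√2 / 2)) ≤ 1 := by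
    have : 1 ≤ √2 := Real.one_le_sqrt.2 (by norm_num)
    rw [div_le_one (by positivity)]; linarith
  have hcos : (1 + Real.cos φ) / 2 ≤ Real.exp (-(1 / (16 * N ^ 2))) := by
    have hsin := Real.mul_le_sin (x := φ / 2) (by positivity) (by linarith [Real.pi_pos])
    have e : 2 / Real.pi * (φ / 2) = 1 / (4 * N) := by
      rw [hφ]; have := Real.pi_pos.ne'; field_simp
    rw [e] at hsin
    have e2 : Real.cos φ = 1 - 2 * Real.sin (φ / 2) ^ 2 := by
      have h1 := Real.cos_two_mul (φ / 2)
      have h2 := Real.sin_sq_add_cos_sq (φ / 2)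
      rw [mul_div_cancel₀ _ (two_ne_zero)] at h1
      linarith
    have h3 : (1 / (4 * N)) ^ 2 ≤ Real.sin (φ / 2) ^ 2 := by gcongr
    have h4 : (1 / (4 * N)) ^ 2 = 1 / (16 * N ^ 2) := by rw [div_pow]; ring
    have := Real.add_one_le_exp (-(1 / (16 * N ^ 2)))
    rw [h4] at h3
    linarith
  have hc0 : 0 < Real.cos φ :=
    Real.cos_pos_of_mem_Ioo ⟨by linarith [Real.pi_pos], by linarith [Real.pi_pos]⟩
  set w := 2 / (1 + Real.cos φ) with hw
  have hw1 : 1 ≤ w := by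
    rw [hw, le_div_iff₀ (by positivity)]; linarith [Real.cos_le_one φ]
  have hw0 : 0 < w := by linarith
  have hwinv : w⁻¹ = (1 + Real.cos φ) / 2 := by rw [hw, inv_div]
  have h5 : ∑ j ∈ Finset.range n, PowerSeries.coeff (k + j) (PowerSeries.rescale w (Fser (2 ^ s)))
      ≤ 1 := by
    refine le_trans ?_ hle1
    have := sum_le_hasSum ((Finset.range n).image (k + ·))
      (fun i _ => rescale_nonneg hw0.le (2 ^ s) i) h
    rwa [Finset.sum_image (fun a _ b _ hab => Nat.add_left_cancel hab)] at this
  have h6 : w ^ k * ∑ j ∈ Finset.range n, PowerSeries.coeff (k + j) (Fser (2 ^ s)) ≤ 1 := by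
    refine le_trans ?_ h5
    rw [Finset.mul_sum]
    apply Finset.sum_le_sum
    intro j _
    rw [PowerSeries.coeff_rescale]
    apply mul_le_mul_of_nonneg_right _ (Fser_nonneg _ _)
    exact pow_le_pow_right₀ hw1 (by omega)
  have h7 : ∑ j ∈ Finset.range n, PowerSeries.coeff (k + j) (Fser (2 ^ s)) ≤ (w⁻¹) ^ k := by
    rw [inv_pow, ← one_div, le_div_iff₀ (by positivity)]; linarith
  refine h7.trans ?_
  rw [hwinv]
  calc _ ≤ (Real.exp (-(1 / (16 * N ^ 2)))) ^ k := by gcongr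
    _ = _ := by
      rw [← Real.exp_nat_mul]
      congr 1
      have : (4 : ℝ) ^ s = N ^ 2 := by rw [hN, ← pow_mul, mul_comm, pow_mul]; norm_num
      rw [this]; field_simp

lemma Aseq_nat (s k : ℕ) : Aseq s (k : ℤ) = PowerSeries.coeff k (Fser (2 ^ s)) := by
  simp [Aseq, Fser, div_eq_mul_inv, mul_comm]

lemma Aseq_neg (s : ℕ) (k : ℤ) (hk : k < 0) : Aseq s k = 0 := by
  simp [Aseq, not_le.2 hk]

lemma Aseq_zero (s : ℕ) : Aseq s 0 = 0 := by
  have h := Aseq_nat s 0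
  have : PowerSeries.coeff 0 (Fser (2 ^ s)) = 0 := by
    obtain ⟨d, hd⟩ : ∃ d, 2 ^ s = d + 1 := ⟨2 ^ s - 1, by have : 0 < 2 ^ s := by positivity
                                                          omega⟩
    simp [Fser, hd, xfun]
  rw [this] at h
  exact_mod_cast h

lemma part_one (s : ℕ) : ∑' k : ℤ, Aseq s k = 1 / 2 := by
  have h := hasSum_cos 0 le_rfl s (by simp; positivity)
  have e : (2 : ℝ) / (1 + Real.cos 0) = 1 := by norm_num
  rw [e, mul_zero, Real.cos_zero] at h
  have h2 : HasSum (fun k : ℕ => Aseq s (k : ℤ)) (1 / 2) := by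
    simp only [Aseq_nat]
    simpa using h
  have h3 : HasSum (Aseq s) (1 / 2) := by
    rw [← Function.Injective.hasSum_iff (g := ((↑) : ℕ → ℤ)) Nat.cast_injective] 
    · exact h2
    · intro x hx
      apply Aseq_neg
      by_contra hneg
      exact hx ⟨x.toNat, Int.toNat_of_nonneg (not_lt.1 hneg)⟩
  exact h3.tsum_eq

lemma Aseq_step {C : ℝ} (hC : 0 < C) (h : ∀ s k : ℕ,
    |PowerSeries.coeff (k + 1) (Fser (2 ^ s)) - PowerSeries.coeff k (Fser (2 ^ s))| ≤
      C / ((2 : ℝ) ^ s) ^ 4) (s : ℕ) (k : ℤ) :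
    |Aseq s (k + 1) - Aseq s k| ≤ C / ((2 : ℝ) ^ s) ^ 4 := by
  rcases lt_or_ge k 0 with hk | hk
  · rw [Aseq_neg s k hk]
    have : Aseq s (k + 1) = 0 := by
      rcases lt_or_ge (k + 1) 0 with hk' | hk'
      · exact Aseq_neg s _ hk'
      · rw [show k + 1 = 0 by omega]; exact Aseq_zero s
    rw [this]; simp; positivity
  · obtain ⟨n, rfl⟩ := Int.eq_ofNat_of_zero_le hk
    have := h s n
    rw [← Aseq_nat, ← Aseq_nat] at this
    exact_mod_cast this

lemma Aseq_lip {s : ℕ} {L : ℝ} (h : ∀ k, |Aseq s (k + 1) - Aseq s k| ≤ L) (k₁ k₂ : ℤ) :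
    |Aseq s k₁ - Aseq s k₂| ≤ L * |(k₁ : ℝ) - k₂| := by
  have h1 : ∀ (n : ℕ) (k : ℤ), |Aseq s (k + n) - Aseq s k| ≤ L * n := by
    intro n k
    induction n with
    | zero => simp
    | succ n ih =>
      have h2 := h (k + n)
      have h3 := abs_add_le (Aseq s (k + n + 1) - Aseq s (k + n)) (Aseq s (k + n) - Aseq s k)
      rw [sub_add_sub_cancel] at h3
      push_cast
      rw [← add_assoc]
      linarith
  rcases le_total k₁ k₂ with hk | hk
  · obtain ⟨n, rfl⟩ := Int.le.dest hk
    rw [abs_sub_comm, abs_sub_comm (k₁ : ℝ)]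
    have := h1 n k₁
    push_cast
    rwa [add_sub_cancel_left, Nat.abs_cast]
  · obtain ⟨n, rfl⟩ := Int.le.dest hk
    have := h1 n k₂
    push_cast
    rwa [add_sub_cancel_left, Nat.abs_cast]

theorem Aseq_satisfies_I_II_III :
    (∀ s : ℕ, ∑' k : ℤ, Aseq s k = 1 / 2) ∧
    (∀ r : ℕ, ∃ C : ℝ, ∀ s : ℕ, ∀ k : ℤ, 0 < k →
      Aseq s k ≤ C * (4 : ℝ) ^ (-(s : ℝ)) * ((4 : ℝ) ^ (s : ℕ) / (k : ℝ)) ^ r) ∧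
    (∃ C : ℝ, ∀ s : ℕ, ∀ k₁ k₂ : ℤ,
      |Aseq s k₁ - Aseq s k₂| ≤
        C * (|(k₁ : ℝ) - (k₂ : ℝ)| * (16 : ℝ) ^ (-(s : ℝ)) + (8 : ℝ) ^ (-(s : ℝ)))) := by

  obtain ⟨C, hC, hlip⟩ := exists_lip
  refine ⟨part_one, ?_, ?_⟩
  · intro r
    refine ⟨√(2 * C * (2 * r).factorial) * 16 ^ r, ?_⟩
    intro s k hk
    obtain ⟨n, rfl⟩ := Int.eq_ofNat_of_zero_le hk.le
    have hn : 0 < n := by simpa using hk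
    have hn' : (0 : ℝ) < n := by exact_mod_cast hn
    rw [Aseq_nat]
    have hw := window_bound (a := fun k => PowerSeries.coeff k (Fser (2 ^ s)))
      (L := C / ((2 : ℝ) ^ s) ^ 4) (by positivity) (fun k => Fser_nonneg _ k) (hlip s) n
      (fun m => tail_bound s n m)
    have e1 : (4 : ℝ) ^ (-(s : ℝ)) = 1 / 4 ^ s := by
      rw [Real.rpow_neg (by norm_num), Real.rpow_natCast, one_div]
    have e2 : ((2 : ℝ) ^ s) ^ 4 = (4 ^ s) ^ 2 := by
      rw [← pow_mul, ← pow_mul, show s * 4 = 2 * (s * 2) by ring, pow_mul]; norm_num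
    rw [e1]
    rw [e2] at hw
    simp only [Int.cast_natCast]
    set Q : ℝ := 4 ^ s
    have hQ : 0 < Q := by positivity
    have hexp := pow_exp_neg (2 * r) ((n : ℝ) / (16 * Q)) (by positivity)
    have hexp2 : Real.exp (-((n : ℝ) / (16 * Q))) ≤
        (2 * r).factorial * (16 * Q / n) ^ (2 * r) := by
      have h3 : (((n : ℝ) / (16 * Q)) ^ (2 * r)) * ((16 * Q / n) ^ (2 * r)) = 1 := by
        rw [← mul_pow]
        have : (n : ℝ) / (16 * Q) * (16 * Q / n) = 1 := by field_simp
        rw [this, one_pow]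
      calc _ = ((n : ℝ) / (16 * Q)) ^ (2 * r) * Real.exp (-((n : ℝ) / (16 * Q))) *
            (16 * Q / n) ^ (2 * r) := by linear_combination (-Real.exp (-((n : ℝ) / (16 * Q)))) * h3
        _ ≤ _ := by gcongr
    apply abs_le_of_sq_le_sq' _ (by positivity) |>.2
    refine hw.trans ?_
    calc 2 * (C / Q ^ 2) * Real.exp (-((n : ℝ) / (16 * Q)))
        ≤ 2 * (C / Q ^ 2) * ((2 * r).factorial * (16 * Q / n) ^ (2 * r)) := by gcongr
      _ = (2 * C * (2 * r).factorial) * (16 ^ r * (1 / Q) * (Q / n) ^ r) ^ 2 := by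
        rw [mul_div_assoc, mul_pow 16, mul_pow, mul_pow, ← pow_mul, ← pow_mul, mul_comm r 2]
        ring
      _ = _ := by
        have h4 := Real.sq_sqrt (by positivity : 0 ≤ 2 * C * ((2 * r).factorial : ℝ))
        linear_combination (-(16 ^ r * (1 / Q) * (Q / n) ^ r) ^ 2) * h4
  · refine ⟨C, ?_⟩
    intro s k₁ k₂
    have h := Aseq_lip (Aseq_step hC hlip s) k₁ k₂
    have e1 : (16 : ℝ) ^ (-(s : ℝ)) = 1 / ((2 : ℝ) ^ s) ^ 4 := by
      rw [Real.rpow_neg (by norm_num), Real.rpow_natCast, one_div, ← pow_mul, mul_comm, pow_mul]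
      norm_num
    have e2 : 0 ≤ C * (8 : ℝ) ^ (-(s : ℝ)) := by positivity
    rw [e1, mul_add]
    refine h.trans (le_trans (le_of_eq ?_) (le_add_of_nonneg_right e2))
    ring
end
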